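/- arXiv:quant-ph/0603175 — 4 statements merged into one kernel-verified Lean document; each statement's English description precedes it below -/
import Mathlib

section
/- Iterated integrals lemma (Lemma 5): Let 0 ≤ m ≤ k. For every j ∈ ℕ and every collection X₁, …, X_j of m-times continuously differentiable operator-valued functions on [0,1], each compactly supported in (0,1), define A_j(X₁,…,X_j) := Q₀ ∫₀¹ ds₁ X₁[s₁] Q₀ ∫₀^{s₁} ds₂ X₂[s₂] Q₀ ⋯ Q₀ ∫₀^{s_{j−1}} ds_j X_j[s_j] P₀ Ω_τ(s_j) P₀. Then there exists a constant C (depending on j, the X_i's and H but not on τ) such that ‖A_j(X₁,…,X_j)‖ ≤ C/τ^m for all τ ≥ 1. -/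
/-- The nested integral
`nestedIter B Q0 [X₁,…,X_j] s = ∫₀ˢ X₁(s₁) Q₀ ∫₀^{s₁} X₂(s₂) Q₀ ⋯ Q₀ ∫₀^{s_{j−1}} X_j(s_j) B(s_j)`,
where the innermost factor is `B` (no `Q₀` between `X_j` and `B`), and
`nestedIter B Q0 [] s = B s`. -/
noncomputable def nestedIter {V : Type*} [NormedAddCommGroup V] [InnerProductSpace ℂ V]
    [FiniteDimensional ℂ V] (B : ℝ → V →L[ℂ] V) (Q0 : V →L[ℂ] V) :
    List (ℝ → V →L[ℂ] V) → ℝ → V →L[ℂ] V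
  | [], s => B s
  | [X], s => ∫ t in (0:ℝ)..s, X t ∘L B t
  | X :: Y :: rest, s => ∫ t in (0:ℝ)..s, X t ∘L Q0 ∘L nestedIter B Q0 (Y :: rest) t

set_option linter.unusedSectionVars false
set_option linter.unusedSimpArgs false

section AdiabaticHelpers

variable {A : Type*} [CStarAlgebra A]

/-- `C^m` with compact support in `(0,1)`. -/
def AGood (m : ℕ) (X : ℝ → A) : Prop :=
  ContDiff ℝ m X ∧ tsupport X ⊆ Set.Ioo (0:ℝ) 1

lemma AGood.of_contDiffOn {m : ℕ} {X : ℝ → A}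
    (h : ContDiffOn ℝ m X (Set.Ioo (0:ℝ) 1)) (hs : tsupport X ⊆ Set.Ioo (0:ℝ) 1) :
    AGood m X := by
  refine ⟨contDiff_iff_contDiffAt.2 fun s => ?_, hs⟩
  by_cases hX : s ∈ tsupport X
  · exact h.contDiffAt (isOpen_Ioo.mem_nhds (hs hX))
  · have : X =ᶠ[nhds s] fun _ => 0 := notMem_tsupport_iff_eventuallyEq.1 hX
    exact contDiffAt_const.congr_of_eventuallyEq this

lemma AGood.mono {m n : ℕ} {X : ℝ → A} (h : AGood m X) (hn : n ≤ m) : AGood n X :=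
  ⟨h.1.of_le (by exact_mod_cast hn), h.2⟩

lemma AGood.deriv {m : ℕ} {X : ℝ → A} (h : AGood (m+1) X) : AGood m (deriv X) := by
  refine ⟨?_, ?_⟩
  · have := h.1
    rw [show ((m+1 : ℕ) : WithTop ℕ∞) = (m : WithTop ℕ∞) + 1 by push_cast; rfl] at this
    exact (contDiff_succ_iff_deriv.1 this).2.2
  · exact (closure_minimal support_deriv_subset (isClosed_tsupport X)).trans h.2

lemma AGood.mul {m : ℕ} {X Y : ℝ → A} (h : AGood m X) (h' : AGood m Y) :
    AGood m (fun s => X s * Y s) :=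
  ⟨h.1.mul h'.1, tsupport_mul_subset_left.trans h.2⟩

lemma AGood.sub {m : ℕ} {X Y : ℝ → A} (h : AGood m X) (h' : AGood m Y) :
    AGood m (fun s => X s - Y s) :=
  ⟨h.1.sub h'.1, (tsupport_sub X Y).trans (Set.union_subset h.2 h'.2)⟩

lemma AGood.zero {m : ℕ} {X : ℝ → A} (h : AGood m X) {s : ℝ}
    (hs : s ∉ Set.Ioo (0:ℝ) 1) : X s = 0 :=
  image_eq_zero_of_notMem_tsupport fun h' => hs (h.2 h')

lemma AGood.bdd {m : ℕ} {X : ℝ → A} (h : AGood m X) :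
    ∃ C, 0 ≤ C ∧ ∀ s ∈ Set.Icc (0:ℝ) 1, ‖X s‖ ≤ C := by
  obtain ⟨C, hC⟩ := isCompact_Icc.exists_bound_of_continuousOn
    (h.1.continuous.continuousOn (s := Set.Icc (0:ℝ) 1))
  exact ⟨C, (norm_nonneg _).trans (hC 0 (by simp)), hC⟩

lemma contDiffOn_of_chain (m : ℕ) : ∀ (F : ℕ → ℝ → A),
    (∀ d < m, ∀ s ∈ Set.Icc (0:ℝ) 1, HasDerivAt (F d) (F (d+1) s) s) →
    ContinuousOn (F m) (Set.Icc (0:ℝ) 1) → ContDiffOn ℝ m (F 0) (Set.Ioo (0:ℝ) 1) := by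
  induction m with
  | zero =>
    intro F _ hc
    simpa using hc.mono Set.Ioo_subset_Icc_self
  | succ m ih =>
    intro F hd hc
    have h1 := ih (fun d => F (d+1)) (fun d hdm s hs => hd (d+1) (by omega) s hs) hc
    rw [show ((m+1 : ℕ) : WithTop ℕ∞) = (m : WithTop ℕ∞) + 1 by push_cast; rfl,
      contDiffOn_succ_iff_deriv_of_isOpen isOpen_Ioo]
    refine ⟨fun s hs => (hd 0 (by omega) s
      (Set.Ioo_subset_Icc_self hs)).differentiableAt.differentiableWithinAt, by simp, ?_⟩
    exact h1.congr fun s hs => (hd 0 (by omega) s (Set.Ioo_subset_Icc_self hs)).deriv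

/-- left/right multiplication -/
noncomputable def aL (Z : A) : A →L[ℂ] A :=
  ContinuousLinearMap.mul ℂ A Z
noncomputable def aR (Z : A) : A →L[ℂ] A :=
  (ContinuousLinearMap.mul ℂ A).flip Z

noncomputable def sylvT (H P : A) : A →L[ℂ] A :=
  (aL H - aR H) * (aL (1 - P) * aR P) + (1 - aL (1 - P) * aR P)

lemma sylvT_apply (H P Y : A) : sylvT H P Y =
    (H * ((1 - P) * (Y * P)) - ((1 - P) * (Y * P)) * H) + (Y - (1 - P) * (Y * P)) := rfl

lemma sylvT_proj {H P : A} (hP : P * P = P) (hPH : H * P = P * H)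
    {Y Z : A} (h : sylvT H P Y = (1 - P) * (Z * P)) :
    P * Y = 0 ∧ Y * P = Y ∧ H * Y - Y * H = (1 - P) * (Z * P) := by
  rw [sylvT_apply] at h
  have hP' : ∀ W, P * (P * W) = P * W := fun W => by rw [← mul_assoc, hP]
  have hPH' : ∀ W, H * (P * W) = P * (H * W) := fun W => by rw [← mul_assoc, hPH, mul_assoc]
  have e : Y = (1 - P) * (Y * P) := by
    have h2 := congrArg (fun W => W - (1 - P) * (W * P)) h
    simp only [mul_sub, sub_mul, mul_add, add_mul, mul_assoc, hP, hP', hPH, hPH', one_mul] at h2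
    simp only [mul_sub, sub_mul, mul_assoc, one_mul]
    rw [← sub_eq_zero]
    have h3 : ∀ Y Z : A, Y = Z → Z = 0 → Y = 0 := fun Y Z h h' => h.trans h'
    refine h3 _ _ ?_ (h2.trans ?_) <;> abel
  rw [← e, sub_self, add_zero] at h
  refine ⟨?_, ?_, h⟩
  · rw [e, sub_mul, one_mul, mul_sub, hP', sub_self]
  · rw [e]; simp only [mul_assoc, hP]

lemma contDiffOn_inv_apply {W : Type*} [NormedAddCommGroup W] [NormedSpace ℂ W] [CompleteSpace W]
    {m : ℕ} {S : Set ℝ} {T : ℝ → W →L[ℂ] W} {f : ℝ → W} (hT : ContDiffOn ℝ m T S)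
    (hf : ContDiffOn ℝ m f S) (hu : ∀ s ∈ S, Function.Bijective (T s)) :
    ContDiffOn ℝ m (fun s => (Ring.inverse (T s)) (f s)) S ∧
      ∀ s ∈ S, T s ((Ring.inverse (T s)) (f s)) = f s := by
  have hu' : ∀ s ∈ S, IsUnit (T s) := fun s hs =>
    ContinuousLinearMap.isUnit_iff_bijective.2 (hu s hs)
  have hIc : ContDiffOn ℝ m (fun s => Ring.inverse (T s)) S := by
    intro s hs
    obtain ⟨u, hu'⟩ := hu' s hs
    have h1 := contDiffAt_ringInverse ℝ (n := m) u
    rw [hu'] at h1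
    exact h1.comp_contDiffWithinAt s (hT s hs)
  have hb : ContDiff ℝ m (fun p : (W →L[ℂ] W) × W => p.1 p.2) :=
    (isBoundedBilinearMap_apply (𝕜 := ℂ) (E := W) (F := W)).contDiff.restrict_scalars ℝ
  refine ⟨hb.comp_contDiffOn (hIc.prodMk hf), fun s hs => ?_⟩
  have h1 : T s * Ring.inverse (T s) = 1 := Ring.mul_inverse_cancel _ (hu' s hs)
  exact congrArg (fun Z : W →L[ℂ] W => Z (f s)) h1

lemma exists_sylv {m : ℕ} {H P X : ℝ → A}
    (hH : ContDiffOn ℝ m H (Set.Ioo (0:ℝ) 1)) (hP : ContDiffOn ℝ m P (Set.Ioo (0:ℝ) 1))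
    (hX : AGood m X)
    (hPP : ∀ s ∈ Set.Ioo (0:ℝ) 1, P s * P s = P s)
    (hPH : ∀ s ∈ Set.Ioo (0:ℝ) 1, H s * P s = P s * H s)
    (hu : ∀ s ∈ Set.Ioo (0:ℝ) 1, Function.Bijective (sylvT (H s) (P s))) :
    ∃ Y : ℝ → A, AGood m Y ∧ ∀ s ∈ Set.Icc (0:ℝ) 1, P s * Y s = 0 ∧ Y s * P s = Y s ∧
      H s * Y s - Y s * H s = (1 - P s) * (X s * P s) := by
  have hWc : ContDiffOn ℝ m (fun s => (1 - P s) * (X s * P s)) (Set.Ioo (0:ℝ) 1) :=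
    (contDiffOn_const.sub hP).mul (hX.1.contDiffOn.mul hP)
  have hLc : ContDiff ℝ m (aL (A := A)) :=
    (ContinuousLinearMap.mul ℂ A).contDiff.restrict_scalars ℝ
  have hRc : ContDiff ℝ m (aR (A := A)) :=
    (ContinuousLinearMap.mul ℂ A).flip.contDiff.restrict_scalars ℝ
  have hTc : ContDiffOn ℝ m (fun s => sylvT (H s) (P s)) (Set.Ioo (0:ℝ) 1) := by
    have hPi : ContDiffOn ℝ m (fun s => aL (1 - P s) * aR (P s)) (Set.Ioo (0:ℝ) 1) :=
      (hLc.comp_contDiffOn (contDiffOn_const.sub hP)).mul (hRc.comp_contDiffOn hP)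
    exact (((hLc.comp_contDiffOn hH).sub (hRc.comp_contDiffOn hH)).mul hPi).add
      (contDiffOn_const.sub hPi)
  obtain ⟨hYc, hYe⟩ := contDiffOn_inv_apply hTc hWc hu
  have hY0 : ∀ s, X s = 0 →
      (Ring.inverse (sylvT (H s) (P s))) ((1 - P s) * (X s * P s)) = 0 := fun s h => by
    simp [h]
  refine ⟨_, AGood.of_contDiffOn hYc (subset_trans (closure_mono fun s hs h =>
    hs (hY0 s h)) hX.2), fun s hs => ?_⟩
  by_cases hs' : s ∈ Set.Ioo (0:ℝ) 1
  · exact sylvT_proj (hPP s hs') (hPH s hs') (hYe s hs')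
  · have hx := hX.zero hs'
    rw [hY0 s hx, hx]; simp


/-- the outer functional; the list of outer operators is given from the inside out -/
noncomputable def aM (Q : A) :
    List (ℝ → A) → (ℝ → A) → A
  | [], f => Q * f 1
  | Y :: L, f => aM Q L (fun s => ∫ t in (0:ℝ)..s, Y t * (Q * f t))

lemma uIcc_sub {s : ℝ} (hs : s ∈ Set.Icc (0:ℝ) 1) : Set.uIcc 0 s ⊆ Set.Icc (0:ℝ) 1 := by
  rw [Set.uIcc_of_le hs.1]; exact Set.Icc_subset_Icc_right hs.2

lemma ii_of_cont {f : ℝ → A} (hf : ContinuousOn f (Set.Icc (0:ℝ) 1)) {s : ℝ}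
    (hs : s ∈ Set.Icc (0:ℝ) 1) : IntervalIntegrable f MeasureTheory.volume 0 s :=
  (hf.mono (uIcc_sub hs)).intervalIntegrable

lemma prim_cont {f : ℝ → A} (hf : ContinuousOn f (Set.Icc (0:ℝ) 1)) :
    ContinuousOn (fun s => ∫ t in (0:ℝ)..s, f t) (Set.Icc (0:ℝ) 1) := by
  have := intervalIntegral.continuousOn_primitive_interval'
    (ii_of_cont hf (s := 1) (by simp)) (a := 0) (by simp)
  rwa [Set.uIcc_of_le zero_le_one] at this

lemma int_lmul {f : ℝ → A} (hf : ContinuousOn f (Set.Icc (0:ℝ) 1)) {s : ℝ}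
    (hs : s ∈ Set.Icc (0:ℝ) 1) (Z : A) :
    ∫ t in (0:ℝ)..s, Z * f t = Z * ∫ t in (0:ℝ)..s, f t :=
  (ContinuousLinearMap.mul ℂ A Z).intervalIntegral_comp_comm (ii_of_cont hf hs)

lemma ftc {F F' : ℝ → A} (hF : ContinuousOn F (Set.Icc (0:ℝ) 1))
    (hd : ∀ t ∈ Set.Ioo (0:ℝ) 1, HasDerivAt F (F' t) t)
    (hF' : ContinuousOn F' (Set.Icc (0:ℝ) 1)) {s : ℝ} (hs : s ∈ Set.Icc (0:ℝ) 1) :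
    ∫ t in (0:ℝ)..s, F' t = F s - F 0 :=
  intervalIntegral.integral_eq_sub_of_hasDerivAt_of_le hs.1
    (hF.mono (Set.Icc_subset_Icc_right hs.2))
    (fun t ht => hd t ⟨ht.1, ht.2.trans_le hs.2⟩) (ii_of_cont hF' hs)

lemma aM_congr (Q : A) (L : List (ℝ → A)) : ∀ {f g : ℝ → A},
    Set.EqOn f g (Set.Icc (0:ℝ) 1) → aM Q L f = aM Q L g := by
  induction L with
  | nil => intro f g h; simp only [aM]; rw [h (by simp)]
  | cons Y L ih =>
    intro f g h
    refine ih fun s hs => ?_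
    refine intervalIntegral.integral_congr fun t ht => ?_
    simp only [h (uIcc_sub hs ht)]

lemma aM_add (Q : A) (L : List (ℝ → A))
    (hL : ∀ Y ∈ L, ContinuousOn Y (Set.Icc (0:ℝ) 1)) : ∀ {f g : ℝ → A},
    ContinuousOn f (Set.Icc (0:ℝ) 1) → ContinuousOn g (Set.Icc (0:ℝ) 1) →
    aM Q L (fun s => f s + g s) = aM Q L f + aM Q L g := by
  induction L with
  | nil => intro f g _ _; simp only [aM, mul_add]
  | cons Y L ih =>
    intro f g hf hg
    have hY := hL Y (by simp)
    have h1 : ContinuousOn (fun t => Y t * (Q * f t)) (Set.Icc (0:ℝ) 1) :=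
      hY.mul (continuousOn_const.mul hf)
    have h2 : ContinuousOn (fun t => Y t * (Q * g t)) (Set.Icc (0:ℝ) 1) :=
      hY.mul (continuousOn_const.mul hg)
    simp only [aM]
    rw [← ih (fun Z hZ => hL Z (by simp [hZ])) (prim_cont h1) (prim_cont h2)]
    refine aM_congr Q L fun s hs => ?_
    simp only [mul_add]
    exact intervalIntegral.integral_add (ii_of_cont h1 hs) (ii_of_cont h2 hs)

lemma aM_smul (Q : A) (L : List (ℝ → A)) (c : ℂ) : ∀ (f : ℝ → A),
    aM Q L (fun s => c • f s) = c • aM Q L f := by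
  induction L with
  | nil => intro f; simp only [aM, mul_smul_comm]
  | cons Y L ih =>
    intro f
    simp only [aM]
    rw [← ih]
    simp only [mul_smul_comm, intervalIntegral.integral_smul]

lemma aM_Q (Q : A) (hQ : Q * Q = Q) (L : List (ℝ → A)) (f : ℝ → A) :
    aM Q L (fun s => Q * f s) = aM Q L f := by
  have h : ∀ W, Q * (Q * W) = Q * W := fun W => by rw [← mul_assoc, hQ]
  cases L <;> simp only [aM, h]

/-- dressing `Z[s]` -/
noncomputable def aD (u X : ℝ → A) : ℝ → A :=
  fun t => star (u t) * (X t * u t)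

lemma aD_cont {u X : ℝ → A} (hu : ContinuousOn u (Set.Icc (0:ℝ) 1))
    (hX : ContinuousOn X (Set.Icc (0:ℝ) 1)) : ContinuousOn (aD u X) (Set.Icc (0:ℝ) 1) :=
  hu.star.mul (hX.mul hu)

structure ASt (k : ℕ) (H P K : ℝ → A) : Prop where
  Hsa : ∀ s ∈ Set.Ioo (0:ℝ) 1, star (H s) = H s
  Ksa : ∀ s ∈ Set.Ioo (0:ℝ) 1, star (K s) = -K s
  PP : ∀ s ∈ Set.Icc (0:ℝ) 1, P s * P s = P s
  PH : ∀ s ∈ Set.Ioo (0:ℝ) 1, H s * P s = P s * H s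
  dP : ∀ s ∈ Set.Ioo (0:ℝ) 1, HasDerivAt P (K s * P s - P s * K s) s
  QK : ∀ s ∈ Set.Icc (0:ℝ) 1, (1 - P s) * K s = (1 - P s) * (K s * P s)
  cP : ContinuousOn P (Set.Icc (0:ℝ) 1)
  gK : AGood k K

structure AEvo (H K U u : ℝ → A) (τ : ℝ) : Prop where
  cu : ContinuousOn u (Set.Icc (0:ℝ) 1)
  cU : ContinuousOn U (Set.Icc (0:ℝ) 1)
  uu : ∀ s ∈ Set.Icc (0:ℝ) 1, star (u s) * u s = 1
  uu' : ∀ s ∈ Set.Icc (0:ℝ) 1, u s * star (u s) = 1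
  UU : ∀ s ∈ Set.Icc (0:ℝ) 1, star (U s) * U s = 1
  du : ∀ s ∈ Set.Ioo (0:ℝ) 1,
    HasDerivAt u (((-(Complex.I * (τ : ℂ))) • H s + K s) * u s) s
  dU : ∀ s ∈ Set.Ioo (0:ℝ) 1, HasDerivAt U ((-(Complex.I * (τ : ℂ))) • (H s * U s)) s
  u0 : u 0 = 1
  U0 : U 0 = 1

lemma norm_le_one_of_iso {Z : A} (h : star Z * Z = 1) : ‖Z‖ ≤ 1 := by
  have h1 : ‖star Z * Z‖ = ‖Z‖ * ‖Z‖ := CStarRing.norm_star_mul_self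
  rw [h] at h1
  have h2 : ‖(1 : A)‖ ≤ 1 := by
    have h3 : ‖star (1:A) * 1‖ = ‖(1:A)‖ * ‖(1:A)‖ := CStarRing.norm_star_mul_self
    rw [star_one, one_mul] at h3
    nlinarith [norm_nonneg (1:A)]
  nlinarith [norm_nonneg Z]

section evo
variable {k : ℕ} {H P K U u : ℝ → A} {τ : ℝ}

lemma AEvo.dstar (hS : ASt k H P K) (hE : AEvo H K U u τ) {s : ℝ} (hs : s ∈ Set.Ioo (0:ℝ) 1) :
    HasDerivAt (fun t => star (u t)) (star (u s) * ((Complex.I * (τ : ℂ)) • H s - K s)) s := by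
  have h := (hE.du s hs).star
  refine HasDerivAt.congr_deriv h ?_
  rw [star_mul, star_add, star_smul, hS.Hsa s hs, hS.Ksa s hs]
  simp [sub_eq_add_neg]

lemma AEvo.dD (hS : ASt k H P K) (hE : AEvo H K U u τ) {s : ℝ} (hs : s ∈ Set.Ioo (0:ℝ) 1)
    {Y : ℝ → A} {Y' : A} (hY : HasDerivAt Y Y' s) :
    HasDerivAt (aD u Y) (star (u s) * (((Complex.I * (τ : ℂ)) • (H s * Y s - Y s * H s)
      - (K s * Y s - Y s * K s) + Y') * u s)) s := by
  have h := (AEvo.dstar hS hE hs).mul (hY.mul (hE.du s hs))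
  refine HasDerivAt.congr_deriv h ?_
  simp only [mul_add, add_mul, mul_sub, sub_mul, smul_mul_assoc, mul_smul_comm, smul_sub,
    mul_assoc, neg_smul, mul_neg, neg_mul, Pi.mul_apply]
  abel

lemma AEvo.inter (hS : ASt k H P K) (hE : AEvo H K U u τ) {s : ℝ} (hs : s ∈ Set.Icc (0:ℝ) 1) :
    star (u s) * (P s * u s) = P 0 := by
  have h := ftc (F := aD u P) (F' := fun _ => 0) (aD_cont hE.cu hS.cP) (fun t ht => by
    have h := AEvo.dD hS hE ht (hS.dP t ht)
    refine HasDerivAt.congr_deriv h ?_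
    rw [hS.PH t ht]; simp) continuousOn_const hs
  rw [intervalIntegral.integral_zero] at h
  have h0 : aD u P 0 = P 0 := by simp [aD, hE.u0]
  rw [h0] at h
  exact sub_eq_zero.1 h.symm

lemma AEvo.inter1 (hS : ASt k H P K) (hE : AEvo H K U u τ) {s : ℝ} (hs : s ∈ Set.Icc (0:ℝ) 1) :
    P s * u s = u s * P 0 := by
  rw [← hE.inter hS hs, ← mul_assoc, hE.uu' s hs, one_mul]

lemma AEvo.inter2 (hS : ASt k H P K) (hE : AEvo H K U u τ) {s : ℝ} (hs : s ∈ Set.Icc (0:ℝ) 1) :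
    star (u s) * P s = P 0 * star (u s) := by
  rw [← hE.inter hS hs, mul_assoc, mul_assoc, hE.uu' s hs, mul_one]

/-- the innermost factor -/
noncomputable def aB (P U u : ℝ → A) : ℝ → A :=
  fun t => P 0 * ((star (u t) * U t) * P 0)

lemma AEvo.cB (hE : AEvo H K U u τ) : ContinuousOn (aB P U u) (Set.Icc (0:ℝ) 1) :=
  continuousOn_const.mul ((hE.cu.star.mul hE.cU).mul continuousOn_const)

lemma AEvo.dOm (hS : ASt k H P K) (hE : AEvo H K U u τ) {s : ℝ} (hs : s ∈ Set.Ioo (0:ℝ) 1) :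
    HasDerivAt (fun t => star (u t) * U t) (-(aD u K s * (star (u s) * U s))) s := by
  have h := (AEvo.dstar hS hE hs).mul (hE.dU s hs)
  refine HasDerivAt.congr_deriv h ?_
  have e : u s * (star (u s) * U s) = U s := by
    rw [← mul_assoc, hE.uu' s (Set.Ioo_subset_Icc_self hs), one_mul]
  simp only [aD, mul_assoc, e, mul_sub, sub_mul, smul_mul_assoc, mul_smul_comm, neg_smul, mul_neg]
  abel

/-- multiplying a dressed operator -/
lemma AEvo.Q_aD (hS : ASt k H P K) (hE : AEvo H K U u τ) {s : ℝ} (hs : s ∈ Set.Icc (0:ℝ) 1)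
    (X : A) :
    (1 - P 0) * (star (u s) * (X * u s)) = star (u s) * (((1 - P s) * X) * u s) := by
  have h := hE.inter2 hS hs
  simp only [sub_mul, one_mul, mul_sub]
  rw [← mul_assoc (P 0), ← h]
  simp only [mul_assoc]

lemma AEvo.aD_P (hS : ASt k H P K) (hE : AEvo H K U u τ) {s : ℝ} (hs : s ∈ Set.Icc (0:ℝ) 1)
    (X : A) :
    (star (u s) * (X * u s)) * P 0 = star (u s) * ((X * P s) * u s) := by
  simp only [mul_assoc, hE.inter1 hS hs]

lemma AEvo.offdiag (hS : ASt k H P K) (hE : AEvo H K U u τ) {s : ℝ}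
    (hs : s ∈ Set.Icc (0:ℝ) 1) :
    (1 - P 0) * ((star (u s) * U s) * P 0) =
      -((1 - P 0) * ∫ t in (0:ℝ)..s, aD u K t * aB P U u t) := by
  have hcK := aD_cont hE.cu (hS.gK.1.continuous.continuousOn)
  have hc : ContinuousOn (fun t => aD u K t * aB P U u t) (Set.Icc (0:ℝ) 1) := hcK.mul hE.cB
  have h := ftc (F := fun t => (1 - P 0) * ((star (u t) * U t) * P 0))
    (F' := fun t => -((1 - P 0) * (aD u K t * aB P U u t)))
    (continuousOn_const.mul ((hE.cu.star.mul hE.cU).mul continuousOn_const)) (fun t ht => by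
      have ht' := Set.Ioo_subset_Icc_self ht
      have h := ((AEvo.dOm hS hE ht).mul_const (P 0)).const_mul (1 - P 0)
      refine HasDerivAt.congr_deriv h ?_
      rw [neg_mul, mul_neg]
      congr 1
      have e1 : (1 - P 0) * aD u K t = (1 - P 0) * (aD u K t * P 0) := by
        simp only [aD]
        rw [hE.aD_P hS ht', hE.Q_aD hS ht', hE.Q_aD hS ht', hS.QK t ht']
      have e2 := congrArg (fun Z => Z * ((star (u t) * U t) * P 0)) e1
      simp only [aB, mul_assoc] at e2 ⊢
      exact e2)
    ((continuousOn_const.mul hc).neg) hs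
  rw [intervalIntegral.integral_neg, int_lmul hc hs] at h
  rw [h]
  have h00 := hS.PP 0 (by simp)
  simp [hE.u0, hE.U0, sub_mul, h00]

/-- integration by parts -/
lemma AEvo.parts (hS : ASt k H P K) (hE : AEvo H K U u τ) (hτ : τ ≠ 0) {m : ℕ}
    {X Y : ℝ → A} (hX : AGood m X) (hY : AGood (m+1) Y)
    (hXY : ∀ s ∈ Set.Icc (0:ℝ) 1, P s * Y s = 0 ∧ Y s * P s = Y s ∧
      H s * Y s - Y s * H s = (1 - P s) * (X s * P s)) {s : ℝ} (hs : s ∈ Set.Icc (0:ℝ) 1) :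
    (1 - P 0) * ∫ t in (0:ℝ)..s, aD u X t * aB P U u t =
      (Complex.I * (τ : ℂ))⁻¹ • (aD u Y s * aB P U u s
        + ((-1 : ℂ) • (∫ t in (0:ℝ)..s, aD u (fun r => deriv Y r - K r * Y r) t * aB P U u t)
        + ∫ t in (0:ℝ)..s, aD u (fun r => deriv Y r - K r * Y r) t *
          ((1 - P 0) * ∫ t' in (0:ℝ)..t, aD u K t' * aB P U u t'))) := by
  set E : ℝ → A := fun r => deriv Y r - K r * Y r with hEdef
  set Bf := aB P U u with hBf
  set G : ℝ → A := fun t => ∫ t' in (0:ℝ)..t, aD u K t' * Bf t' with hG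
  set c : ℂ := Complex.I * (τ : ℂ) with hc
  have hc0 : c ≠ 0 := mul_ne_zero Complex.I_ne_zero (by exact_mod_cast hτ)
  have cB : ContinuousOn Bf (Set.Icc (0:ℝ) 1) := hE.cB
  have cK := aD_cont hE.cu (hS.gK.1.continuous.continuousOn)
  have cG : ContinuousOn G (Set.Icc (0:ℝ) 1) := prim_cont (cK.mul cB)
  have cX := aD_cont hE.cu hX.1.continuous.continuousOn
  have cY := aD_cont hE.cu hY.1.continuous.continuousOn
  have cE : ContinuousOn (aD u E) (Set.Icc (0:ℝ) 1) := aD_cont hE.cu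
    ((hY.deriv.1.continuous.sub (hS.gK.1.continuous.mul hY.1.continuous)).continuousOn)
  have c1 : ContinuousOn (fun t => aD u X t * Bf t) (Set.Icc (0:ℝ) 1) := cX.mul cB
  have c2 : ContinuousOn (fun t => aD u E t * Bf t) (Set.Icc (0:ℝ) 1) := cE.mul cB
  have c3 : ContinuousOn (fun t => aD u E t * ((1 - P 0) * G t)) (Set.Icc (0:ℝ) 1) :=
    cE.mul (continuousOn_const.mul cG)
  have c1' : ContinuousOn (fun t => c • ((1 - P 0) * (aD u X t * Bf t))) (Set.Icc (0:ℝ) 1) :=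
    (continuousOn_const.mul c1).const_smul c
  have h := ftc (F := fun t => aD u Y t * Bf t)
    (F' := fun t => c • ((1 - P 0) * (aD u X t * Bf t)) + (aD u E t * Bf t
      - aD u E t * ((1 - P 0) * G t)))
    (cY.mul cB) (fun t ht => by
      have ht' := Set.Ioo_subset_Icc_self ht
      have hYd : HasDerivAt Y (deriv Y t) t :=
        ((hY.1.differentiable (by simp)) t).hasDerivAt
      have hd := (AEvo.dD hS hE ht hYd).mul ((AEvo.dOm hS hE ht).mul_const (P 0))
      have heq : (fun t => aD u Y t * Bf t) =ᶠ[nhds t]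
          (fun t => aD u Y t * ((star (u t) * U t) * P 0)) := by
        filter_upwards [isOpen_Ioo.mem_nhds ht] with r hr
        have hr' := Set.Ioo_subset_Icc_self hr
        simp only [hBf, aB, aD]
        rw [← mul_assoc _ (P 0), hE.aD_P hS hr', (hXY r hr').2.1]
      refine HasDerivAt.congr_of_eventuallyEq ?_ heq
      refine HasDerivAt.congr_deriv hd ?_
      rw [(hXY t ht').2.2]
      have e1 : (1 - P 0) * (aD u X t * Bf t) =
          star (u t) * (((1 - P t) * (X t * P t)) * u t) * ((star (u t) * U t) * P 0) := by
        rw [← hE.Q_aD hS ht', ← hE.aD_P hS ht']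
        simp only [hBf, aB, aD, mul_assoc]
      have e2 : aD u E t * Bf t - aD u E t * ((1 - P 0) * G t) =
          aD u E t * ((star (u t) * U t) * P 0) := by
        have := hE.offdiag hS ht'
        rw [← neg_eq_iff_eq_neg] at this
        simp only [hG, hBf]
        rw [← this, mul_neg, sub_neg_eq_add, ← mul_add]
        congr 1
        simp only [aB, sub_mul, one_mul]; abel
      have e3 : aD u Y t * aD u K t = star (u t) * ((Y t * K t) * u t) := by
        simp only [aD, mul_assoc]
        rw [← mul_assoc (u t) (star (u t)), hE.uu' t ht', one_mul]
      rw [e1, e2, neg_mul, mul_neg, ← mul_assoc (aD u Y t), ← mul_assoc (aD u Y t), e3]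
      simp only [aD, hEdef, add_mul, mul_add, sub_mul, mul_sub, smul_mul_assoc, mul_smul_comm,
        mul_assoc]
      abel)
    (c1'.add (c2.sub c3)) hs
  rw [intervalIntegral.integral_add (ii_of_cont c1' hs)
      ((ii_of_cont c2 hs).sub (ii_of_cont c3 hs)),
    intervalIntegral.integral_sub (ii_of_cont c2 hs) (ii_of_cont c3 hs),
    intervalIntegral.integral_smul, int_lmul c1 hs] at h
  have hY0 : aD u Y 0 * Bf 0 = 0 := by
    simp [aD, hY.zero (s := 0) (by simp)]
  simp only [hY0, sub_zero] at h
  rw [eq_inv_smul_iff₀ hc0, ← h, neg_one_smul]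
  abel

end evo

lemma aD_norm {u X : ℝ → A} {s c : ℝ} (hu : ‖u s‖ ≤ 1) (hX : ‖X s‖ ≤ c) :
    ‖aD u X s‖ ≤ c := by
  have h1 : ‖star (u s)‖ ≤ 1 := by rwa [norm_star]
  calc ‖aD u X s‖ ≤ ‖star (u s)‖ * (‖X s‖ * ‖u s‖) :=
        (norm_mul_le _ _).trans (mul_le_mul_of_nonneg_left (norm_mul_le _ _) (norm_nonneg _))
    _ ≤ 1 * (‖X s‖ * 1) := by gcongr
    _ ≤ c := by simpa using hX

lemma int_norm {f : ℝ → A} {c : ℝ} (hf : ∀ s ∈ Set.Icc (0:ℝ) 1, ‖f s‖ ≤ c) {s : ℝ}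
    (hs : s ∈ Set.Icc (0:ℝ) 1) : ‖∫ t in (0:ℝ)..s, f t‖ ≤ c := by
  have h := intervalIntegral.norm_integral_le_of_norm_le_const (a := 0) (b := s) (C := c) (f := f)
    (fun t ht => hf t (uIcc_sub hs (Set.uIoc_subset_uIcc ht)))
  have hc : 0 ≤ c := (norm_nonneg _).trans (hf 0 (by simp))
  rw [sub_zero, abs_of_nonneg hs.1] at h
  nlinarith [hs.2]

lemma aM_bound (Q : A) (L : List (ℝ → A)) : (∀ Y ∈ L, AGood 0 Y) →
    ∃ C, 0 ≤ C ∧ ∀ u : ℝ → A, (∀ s ∈ Set.Icc (0:ℝ) 1, ‖u s‖ ≤ 1) → ∀ (f : ℝ → A) (c : ℝ),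
      (∀ s ∈ Set.Icc (0:ℝ) 1, ‖f s‖ ≤ c) → ‖aM Q (L.map (aD u)) f‖ ≤ C * c := by
  induction L with
  | nil =>
    intro _
    refine ⟨‖Q‖, norm_nonneg _, fun u _ f c hf => ?_⟩
    exact (norm_mul_le _ _).trans
      (mul_le_mul_of_nonneg_left (hf 1 (by simp)) (norm_nonneg _))
  | cons Y L ih =>
    intro hL
    obtain ⟨C, hC, h⟩ := ih fun Z hZ => hL Z (by simp [hZ])
    obtain ⟨D, hD, hYb⟩ := (hL Y (by simp)).bdd
    refine ⟨C * (D * ‖Q‖), by positivity, fun u hu f c hf => ?_⟩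
    have := h u hu (fun s => ∫ t in (0:ℝ)..s, aD u Y t * (Q * f t)) (D * (‖Q‖ * c)) (by
      intro s hs
      refine int_norm (fun t ht => ?_) hs
      refine (norm_mul_le _ _).trans ?_
      refine mul_le_mul (aD_norm (hu t ht) (hYb t ht)) ((norm_mul_le _ _).trans
        (mul_le_mul_of_nonneg_left (hf t ht) (norm_nonneg _))) (norm_nonneg _) hD)
    simp only [List.map_cons, aM]
    calc _ ≤ _ := this
      _ = _ := by ring

lemma main_claim {k : ℕ} {H P K : ℝ → A} (hS : ASt k H P K)
    (hH : ContDiffOn ℝ ((k+1 : ℕ) : WithTop ℕ∞) H (Set.Ioo (0:ℝ) 1))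
    (hP : ContDiffOn ℝ ((k+1 : ℕ) : WithTop ℕ∞) P (Set.Ioo (0:ℝ) 1))
    (hu : ∀ s ∈ Set.Ioo (0:ℝ) 1, Function.Bijective (sylvT (H s) (P s))) (m : ℕ) :
    m ≤ k + 1 → ∀ (L : List (ℝ → A)) (X : ℝ → A), (∀ Y ∈ L, AGood m Y) → AGood m X →
    ∃ C, 0 ≤ C ∧ ∀ τ ≥ (1:ℝ), ∀ U u : ℝ → A, AEvo H K U u τ →
      ‖aM (1 - P 0) (L.map (aD u)) (fun s => ∫ t in (0:ℝ)..s, aD u X t * aB P U u t)‖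
        ≤ C / τ ^ m := by
  have hQ : (1 - P 0) * (1 - P 0) = 1 - P 0 := by
    have := hS.PP 0 (by simp)
    simp only [sub_mul, mul_sub, this, one_mul, mul_one]; abel
  induction m with
  | zero =>
    intro _ L X hL hX
    obtain ⟨C, hC, h⟩ := aM_bound (1 - P 0) L hL
    obtain ⟨D, hD, hXb⟩ := hX.bdd
    refine ⟨C * (D * (‖P 0‖ * ‖P 0‖)), by positivity, fun τ hτ U u hE => ?_⟩
    rw [pow_zero, div_one]
    have hu1 : ∀ s ∈ Set.Icc (0:ℝ) 1, ‖u s‖ ≤ 1 := fun s hs => norm_le_one_of_iso (hE.uu s hs)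
    refine h u hu1 _ _ fun s hs => int_norm (fun t ht => ?_) hs
    refine (norm_mul_le _ _).trans ?_
    refine mul_le_mul (aD_norm (hu1 t ht) (hXb t ht)) ?_ (norm_nonneg _) hD
    have h1 : ‖star (u t)‖ ≤ 1 := by rw [norm_star]; exact hu1 t ht
    have h2 : ‖U t‖ ≤ 1 := norm_le_one_of_iso (hE.UU t ht)
    calc ‖aB P U u t‖ ≤ ‖P 0‖ * (‖star (u t)‖ * ‖U t‖ * ‖P 0‖) := by
          refine (norm_mul_le _ _).trans (mul_le_mul_of_nonneg_left ?_ (norm_nonneg _))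
          refine (norm_mul_le _ _).trans (mul_le_mul_of_nonneg_right ?_ (norm_nonneg _))
          exact norm_mul_le _ _
      _ ≤ ‖P 0‖ * (1 * 1 * ‖P 0‖) := by gcongr
      _ = ‖P 0‖ * ‖P 0‖ := by ring
  | succ m ih =>
    intro hm L X hL hX
    have hmk : m ≤ k := by omega
    have ih' := ih (by omega)
    have hcast : ((m+1 : ℕ) : WithTop ℕ∞) ≤ ((k+1 : ℕ) : WithTop ℕ∞) := by exact_mod_cast hm
    obtain ⟨Y, hY, hXY⟩ := exists_sylv (hH.of_le hcast) (hP.of_le hcast) hX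
      (fun s hs => hS.PP s (Set.Ioo_subset_Icc_self hs)) hS.PH hu
    have hK : AGood m K := hS.gK.mono hmk
    set E : ℝ → A := fun r => deriv Y r - K r * Y r with hEdef
    have hEg : AGood m E := hY.deriv.sub (hK.mul (hY.mono (by omega)))
    have hL' : ∀ Z ∈ L, AGood m Z := fun Z hZ => (hL Z hZ).mono (by omega)
    -- boundary term
    have t1 : ∃ C, 0 ≤ C ∧ ∀ τ ≥ (1:ℝ), ∀ U u : ℝ → A, AEvo H K U u τ →
        ‖aM (1 - P 0) (L.map (aD u)) (fun s => aD u Y s * aB P U u s)‖ ≤ C / τ ^ m := by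
      cases L with
      | nil =>
        refine ⟨0, le_rfl, fun τ hτ U u hE => ?_⟩
        simp [aM, aD, hY.zero (s := 1) (by simp)]
      | cons Z L =>
        obtain ⟨C, hC, h⟩ := ih' L (fun r => Z r * Y r) (fun W hW => hL' W (by simp [hW]))
          ((hL' Z (by simp)).mul (hY.mono (by omega)))
        refine ⟨C, hC, fun τ hτ U u hE => ?_⟩
        refine le_of_eq_of_le ?_ (h τ hτ U u hE)
        congr 1
        simp only [List.map_cons, aM]
        refine aM_congr _ _ fun s hs => intervalIntegral.integral_congr fun t ht => ?_
        have ht' := uIcc_sub hs ht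
        have e : (1 - P 0) * aD u Y t = aD u Y t := by
          simp only [aD]
          rw [hE.Q_aD hS ht', sub_mul, (hXY t ht').1, one_mul, sub_zero]
        rw [← mul_assoc (1 - P 0), e, ← mul_assoc]
        congr 1
        simp only [aD, mul_assoc]
        rw [← mul_assoc (u t) (star (u t)), hE.uu' t ht', one_mul]
    obtain ⟨C1, hC1, h1⟩ := t1
    obtain ⟨C2, hC2, h2⟩ := ih' L E hL' hEg
    obtain ⟨C3, hC3, h3⟩ := ih' (E :: L) K (by
      intro Z hZ
      rcases List.mem_cons.1 hZ with rfl | hZ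
      · exact hEg
      · exact hL' Z hZ) hK
    refine ⟨C1 + (C2 + C3), by positivity, fun τ hτ U u hE => ?_⟩
    have hτ0 : τ ≠ 0 := by linarith
    have hτp : 0 < τ := by linarith
    have hlc : ∀ Z ∈ L.map (aD u), ContinuousOn Z (Set.Icc (0:ℝ) 1) := by
      intro Z hZ
      obtain ⟨W, hW, rfl⟩ := List.mem_map.1 hZ
      exact aD_cont hE.cu (hL W hW).1.continuous.continuousOn
    have cB : ContinuousOn (aB P U u) (Set.Icc (0:ℝ) 1) := hE.cB
    have cY := aD_cont hE.cu hY.1.continuous.continuousOn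
    have cE := aD_cont hE.cu hEg.1.continuous.continuousOn
    have cK := aD_cont hE.cu hK.1.continuous.continuousOn
    have cI1 : ContinuousOn (fun s => aD u Y s * aB P U u s) (Set.Icc (0:ℝ) 1) := cY.mul cB
    have cI2 : ContinuousOn (fun s => ∫ t in (0:ℝ)..s, aD u E t * aB P U u t)
      (Set.Icc (0:ℝ) 1) := prim_cont (cE.mul cB)
    have cI2' : ContinuousOn (fun s => (-1 : ℂ) • ∫ t in (0:ℝ)..s, aD u E t * aB P U u t)
      (Set.Icc (0:ℝ) 1) := cI2.const_smul (-1 : ℂ)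
    have cI3 : ContinuousOn (fun s => ∫ t in (0:ℝ)..s, aD u E t *
        ((1 - P 0) * ∫ t' in (0:ℝ)..t, aD u K t' * aB P U u t')) (Set.Icc (0:ℝ) 1) :=
      prim_cont (cE.mul (continuousOn_const.mul (prim_cont (cK.mul cB))))
    have cI23 : ContinuousOn (fun s => (-1 : ℂ) • (∫ t in (0:ℝ)..s, aD u E t * aB P U u t) +
        ∫ t in (0:ℝ)..s, aD u E t *
        ((1 - P 0) * ∫ t' in (0:ℝ)..t, aD u K t' * aB P U u t')) (Set.Icc (0:ℝ) 1) :=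
      cI2'.add cI3
    rw [← aM_Q (1 - P 0) hQ]
    rw [aM_congr (1 - P 0) _ (fun s hs => hE.parts hS hτ0 (hX.mono (Nat.le_succ m)) hY hXY hs),
      aM_smul, aM_add _ _ hlc cI1 cI23,
      aM_add _ _ hlc cI2' cI3, aM_smul, norm_smul]
    have hn : ‖(Complex.I * (τ : ℂ))⁻¹‖ = τ⁻¹ := by
      simp [abs_of_pos hτp]
    rw [hn]
    have b1 := h1 τ hτ U u hE
    have b2 := h2 τ hτ U u hE
    have b3 := h3 τ hτ U u hE
    simp only [List.map_cons, aM] at b3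
    rw [← norm_neg, ← neg_one_smul ℂ] at b2
    have b := (norm_add_le _ _).trans (add_le_add b1 ((norm_add_le _ _).trans (add_le_add b2 b3)))
    calc _ ≤ τ⁻¹ * (C1 / τ ^ m + (C2 / τ ^ m + C3 / τ ^ m)) :=
          mul_le_mul_of_nonneg_left b (by positivity)
      _ = (C1 + (C2 + C3)) / τ ^ (m+1) := by
          rw [pow_succ]; field_simp

section concrete

variable {V : Type*} [NormedAddCommGroup V] [InnerProductSpace ℂ V] [FiniteDimensional ℂ V]

lemma aM_nested (Q : V →L[ℂ] V) (B : ℝ → V →L[ℂ] V) (L : List (ℝ → V →L[ℂ] V)) :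
    ∀ (Y : ℝ → V →L[ℂ] V) (R : List (ℝ → V →L[ℂ] V)),
    aM Q L (nestedIter B Q (Y :: R)) = Q * nestedIter B Q (L.reverse ++ Y :: R) 1 := by
  induction L with
  | nil => intro Y R; rfl
  | cons Z L ih =>
    intro Y R
    have h : nestedIter B Q (Z :: Y :: R) =
        fun s => ∫ t in (0:ℝ)..s, Z t * (Q * nestedIter B Q (Y :: R) t) := by
      funext s
      simp only [nestedIter]
      rfl
    have h2 := ih Z (Y :: R)
    rw [h] at h2
    simp only [aM]
    rw [h2]
    simp

/-- Pointwise gap: intertwiners between the band and the rest vanish. -/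
lemma sylv_inj {H P : V →L[ℂ] V} {a b g : ℝ} (hg : 0 < g) (hH : IsSelfAdjoint H)
    (hP : P * P = P) (hPH : H * P = P * H)
    (hband : ∀ (μ : ℝ) (v : V), v ≠ 0 → P v = v → H v = (μ : ℂ) • v → μ ∈ Set.Icc a b)
    (hgap : ∀ (μ : ℝ) (v : V), v ≠ 0 → P v = 0 → H v = (μ : ℂ) • v →
      g ≤ Metric.infDist μ (Set.Icc a b)) (Y : V →L[ℂ] V) (hY : H * Y = Y * H) :
    (P * Y = 0 → Y * P = Y → Y = 0) ∧ (P * Y = Y → Y * P = 0 → Y = 0) := by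
  have hsym : (H : V →ₗ[ℂ] V).IsSymmetric :=
    ContinuousLinearMap.isSelfAdjoint_iff_isSymmetric.1 hH
  have key : ∀ (Z : V →L[ℂ] V), (∀ (μ : ℝ) (v : V), H v = (μ : ℂ) • v → Z v = 0) → Z = 0 := by
    intro Z hZ
    have := (hsym.eigenvectorBasis rfl).toBasis.ext (f₁ := (Z : V →ₗ[ℂ] V)) (f₂ := 0) (by
      intro i
      simp only [OrthonormalBasis.coe_toBasis]
      exact hZ _ _ (hsym.apply_eigenvectorBasis rfl i))
    ext v
    exact congrArg (fun f : V →ₗ[ℂ] V => f v) this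
  have ap : ∀ {A B : V →L[ℂ] V}, A = B → ∀ v, A v = B v := by
    intro A B h v; rw [h]
  have con : ∀ (μ : ℝ) (v w : V), v ≠ 0 → P v = v → H v = (μ : ℂ) • v →
      w ≠ 0 → P w = 0 → H w = (μ : ℂ) • w → False := by
    intro μ v w h1 h2 h3 h4 h5 h6
    have := hgap μ w h4 h5 h6
    rw [Metric.infDist_zero_of_mem (hband μ v h1 h2 h3)] at this
    linarith
  constructor
  · intro h1 h2
    refine key Y fun μ v hv => ?_
    by_contra hne
    have e1 : Y (P v) = Y v := ap h2 v
    refine con μ (P v) (Y v) (fun h => hne ?_) (ap hP v) ?_ hne (ap h1 v) ?_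
    · rw [← e1, h, map_zero]
    · have : H (P v) = P (H v) := ap hPH v
      rw [this, hv, map_smul]
    · have : H (Y v) = Y (H v) := ap hY v
      rw [this, hv, map_smul]
  · intro h1 h2
    refine key Y fun μ v hv => ?_
    by_contra hne
    have e1 : Y (P v) = 0 := ap h2 v
    have e2 : P (P v) = P v := ap hP v
    refine con μ (Y v) (v - P v) hne (ap h1 v) ?_ (fun h => hne ?_) ?_ ?_
    · have : H (Y v) = Y (H v) := ap hY v
      rw [this, hv, map_smul]
    · have : Y (v - P v) = Y v := by rw [map_sub, e1, sub_zero]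
      rw [← this, h, map_zero]
    · rw [map_sub, e2, sub_self]
    · have : H (P v) = P (H v) := ap hPH v
      rw [map_sub, this, hv, map_smul, smul_sub]

lemma sylvT_bij {H P : V →L[ℂ] V} {a b g : ℝ} (hg : 0 < g) (hH : IsSelfAdjoint H)
    (hP : P * P = P) (hPH : H * P = P * H)
    (hband : ∀ (μ : ℝ) (v : V), v ≠ 0 → P v = v → H v = (μ : ℂ) • v → μ ∈ Set.Icc a b)
    (hgap : ∀ (μ : ℝ) (v : V), v ≠ 0 → P v = 0 → H v = (μ : ℂ) • v →
      g ≤ Metric.infDist μ (Set.Icc a b)) : Function.Bijective (sylvT H P) := by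
  have hinj : Function.Injective (sylvT H P) := by
    rw [injective_iff_map_eq_zero]
    intro Y hY
    obtain ⟨h1, h2, h3⟩ := sylvT_proj hP hPH (Y := Y) (Z := 0) (by rw [hY]; simp)
    refine (sylv_inj hg hH hP hPH hband hgap Y ?_).1 h1 h2
    rw [← sub_eq_zero, h3]; simp
  exact ⟨hinj, (LinearMap.injective_iff_surjective
    (f := (sylvT H P : (V →L[ℂ] V) →ₗ[ℂ] (V →L[ℂ] V)))).1 hinj⟩

lemma static_setup (k : ℕ)
    (Hd Pd : ℕ → ℝ → V →L[ℂ] V)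
    (bm bp : ℝ → ℝ) (g : ℝ) (hg : 0 < g)
    (hHsa : ∀ s ∈ Set.Icc (0:ℝ) 1, IsSelfAdjoint (Hd 0 s))
    (hHder : ∀ i < k+1, ∀ s ∈ Set.Icc (0:ℝ) 1, HasDerivAt (Hd i) (Hd (i+1) s) s)
    (hHkc : ContinuousOn (Hd (k+1)) (Set.Icc (0:ℝ) 1))
    (hHsupp : tsupport (Hd 1) ⊆ Set.Ioo (0:ℝ) 1)
    (hPsa : ∀ s ∈ Set.Icc (0:ℝ) 1, IsSelfAdjoint (Pd 0 s))
    (hPidem : ∀ s ∈ Set.Icc (0:ℝ) 1, Pd 0 s * Pd 0 s = Pd 0 s)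
    (hPH : ∀ s ∈ Set.Icc (0:ℝ) 1, Hd 0 s * Pd 0 s = Pd 0 s * Hd 0 s)
    (hPder : ∀ i < k+1, ∀ s ∈ Set.Icc (0:ℝ) 1, HasDerivAt (Pd i) (Pd (i+1) s) s)
    (hPkc : ContinuousOn (Pd (k+1)) (Set.Icc (0:ℝ) 1))
    (hband : ∀ s ∈ Set.Icc (0:ℝ) 1, ∀ (μ : ℝ) (v : V), v ≠ 0 → Pd 0 s v = v →
      Hd 0 s v = (μ : ℂ) • v → μ ∈ Set.Icc (bm s) (bp s))
    (hgap : ∀ s ∈ Set.Icc (0:ℝ) 1, ∀ (μ : ℝ) (v : V), v ≠ 0 → Pd 0 s v = 0 →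
      Hd 0 s v = (μ : ℂ) • v → g ≤ Metric.infDist μ (Set.Icc (bm s) (bp s))) :
    ∃ K : ℝ → V →L[ℂ] V, (∀ s ∈ Set.Ioo (0:ℝ) 1, K s = Pd 1 s * Pd 0 s - Pd 0 s * Pd 1 s) ∧
      ASt k (Hd 0) (Pd 0) K := by
  have hsub := Set.Ioo_subset_Icc_self (a := (0:ℝ)) (b := 1)
  have hP : ContDiffOn ℝ ((k+1 : ℕ) : WithTop ℕ∞) (Pd 0) (Set.Ioo (0:ℝ) 1) :=
    contDiffOn_of_chain (k+1) Pd hPder hPkc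
  have hP1 : ContDiffOn ℝ (k : WithTop ℕ∞) (Pd 1) (Set.Ioo (0:ℝ) 1) :=
    contDiffOn_of_chain k (fun d => Pd (d+1)) (fun d hd s hs => hPder (d+1) (by omega) s hs) hPkc
  have dP : ∀ s ∈ Set.Ioo (0:ℝ) 1, HasDerivAt (Pd 0) (Pd 1 s) s :=
    fun s hs => hPder 0 (by omega) s (hsub hs)
  have dH : ∀ s ∈ Set.Ioo (0:ℝ) 1, HasDerivAt (Hd 0) (Hd 1 s) s :=
    fun s hs => hHder 0 (by omega) s (hsub hs)
  have uniq : ∀ (f h : ℝ → V →L[ℂ] V) (a b : V →L[ℂ] V) (s : ℝ), s ∈ Set.Ioo (0:ℝ) 1 →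
      (∀ r ∈ Set.Icc (0:ℝ) 1, f r = h r) → HasDerivAt f a s → HasDerivAt h b s → a = b := by
    intro f h a b s hs hfh hf hh
    have : h =ᶠ[nhds s] f := by
      filter_upwards [isOpen_Ioo.mem_nhds hs] with r hr
      exact (hfh r (hsub hr)).symm
    exact (hf.congr_of_eventuallyEq this).unique hh
  have e1 : ∀ s ∈ Set.Ioo (0:ℝ) 1, Pd 1 s * Pd 0 s + Pd 0 s * Pd 1 s = Pd 1 s := fun s hs =>
    uniq (fun r => Pd 0 r * Pd 0 r) (Pd 0) _ _ s hs hPidem ((dP s hs).mul (dP s hs)) (dP s hs)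
  have e2 : ∀ s ∈ Set.Ioo (0:ℝ) 1, Hd 1 s * Pd 0 s + Hd 0 s * Pd 1 s =
      Pd 1 s * Hd 0 s + Pd 0 s * Hd 1 s := fun s hs =>
    uniq (fun r => Hd 0 r * Pd 0 r) (fun r => Pd 0 r * Hd 0 r) _ _ s hs hPH
      ((dH s hs).mul (dP s hs)) ((dP s hs).mul (dH s hs))
  have e3 : ∀ s ∈ Set.Ioo (0:ℝ) 1, star (Pd 1 s) = Pd 1 s := fun s hs =>
    uniq (fun r => star (Pd 0 r)) (Pd 0) _ _ s hs hPsa (dP s hs).star (dP s hs)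
  have e4 : ∀ s ∈ Set.Ioo (0:ℝ) 1, Pd 0 s * (Pd 1 s * Pd 0 s) = 0 := by
    intro s hs
    have h := congrArg (fun Z => Pd 0 s * Z) (e1 s hs)
    simp only [mul_add] at h
    rw [← mul_assoc (Pd 0 s) (Pd 0 s) (Pd 1 s), hPidem s (hsub hs)] at h
    exact add_eq_right.1 h
  let K : ℝ → V →L[ℂ] V := (Set.Ioo (0:ℝ) 1).indicator
    (fun s => Pd 1 s * Pd 0 s - Pd 0 s * Pd 1 s)
  have hK : ∀ s ∈ Set.Ioo (0:ℝ) 1, K s = Pd 1 s * Pd 0 s - Pd 0 s * Pd 1 s := fun s hs =>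
    Set.indicator_of_mem hs _
  have hK0 : ∀ s, s ∉ Set.Ioo (0:ℝ) 1 → K s = 0 := fun s hs =>
    Set.indicator_of_notMem hs _
  have hsupp : Function.support K ⊆ Function.support (Hd 1) := by
    intro s hs h0
    by_cases hs' : s ∈ Set.Ioo (0:ℝ) 1
    swap
    · exact hs (hK0 s hs')
    have hi := hsub hs'
    have hPP := hPidem s hi
    have hHP1 := e2 s hs'
    rw [h0, zero_mul, zero_add, mul_zero, add_zero] at hHP1
    have inj := sylv_inj hg (hHsa s hi) hPP (hPH s hi) (hband s hi) (hgap s hi)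
    have y1 : Pd 1 s * Pd 0 s = 0 := by
      refine (inj (Pd 1 s * Pd 0 s) ?_).1 (e4 s hs') (by rw [mul_assoc, hPP])
      rw [← mul_assoc, hHP1, mul_assoc, hPH s hi, mul_assoc]
    have y2 : Pd 0 s * Pd 1 s = 0 := by
      refine (inj (Pd 0 s * Pd 1 s) ?_).2 (by rw [← mul_assoc, hPP])
        (by rw [mul_assoc]; exact e4 s hs')
      rw [← mul_assoc, hPH s hi, mul_assoc, hHP1, mul_assoc]
    exact hs (by rw [hK s hs', y1, y2, sub_zero])
  refine ⟨K, hK, ⟨fun s hs => hHsa s (hsub hs), fun s hs => ?_, hPidem,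
    fun s hs => hPH s (hsub hs), fun s hs => ?_, fun s hs => ?_,
    fun s hs => (hPder 0 (by omega) s hs).continuousAt.continuousWithinAt, ?_⟩⟩
  · have hp : star (Pd 0 s) = Pd 0 s := hPsa s (hsub hs)
    rw [hK s hs, star_sub, star_mul, star_mul, e3 s hs, hp, neg_sub]
  · refine (dP s hs).congr_deriv ?_
    rw [hK s hs]
    have hPP := hPidem s (hsub hs)
    have h4 := e4 s hs
    have h5 : Pd 0 s * (Pd 0 s * Pd 1 s) = Pd 0 s * Pd 1 s := by rw [← mul_assoc, hPP]
    simp only [sub_mul, mul_sub, mul_assoc, hPP, h4, h5]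
    rw [sub_zero, zero_sub, sub_neg_eq_add]
    exact (e1 s hs).symm
  · by_cases hs' : s ∈ Set.Ioo (0:ℝ) 1
    · rw [hK s hs']
      have hPP := hPidem s hs
      have h4 := e4 s hs'
      have h5 : Pd 0 s * (Pd 0 s * Pd 1 s) = Pd 0 s * Pd 1 s := by rw [← mul_assoc, hPP]
      have h6 : Pd 0 s * (Pd 0 s * (Pd 1 s * Pd 0 s)) = 0 := by rw [h4, mul_zero]
      simp only [sub_mul, mul_sub, one_mul, mul_assoc, hPP, h4, h5, h6, mul_zero]
      abel
    · simp [hK0 s hs']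
  · refine AGood.of_contDiffOn ?_ ((closure_mono hsupp).trans hHsupp)
    have hPk := hP.of_le (show (k : WithTop ℕ∞) ≤ ((k+1 : ℕ) : WithTop ℕ∞) by
      exact_mod_cast Nat.le_succ k)
    exact ((hP1.mul hPk).sub (hPk.mul hP1)).congr hK

end concrete

end AdiabaticHelpers

/-- **Iterated integrals lemma (Lemma 5).**

`Hd i` (resp. `Pd i`) is the `i`-th derivative of the `k`-times continuously
differentiable (`k ≥ 2`) family of self-adjoint operators `H = Hd 0` with `Ḣ` compactly
supported in `(0,1)` (resp. of the family of orthogonal projections `P = Pd 0`),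
`P` commuting with `H` and having its band lying in `[bm s, bp s]` separated by a gap
`g > 0` from the rest of the spectrum.  `U τ` and `UA τ` are the unitary Schrödinger
resp. adiabatic propagators, `Ω_τ(s) := UA_τ(s)* U_τ(s)` the wave operator, and
`Z[s] := UA_τ(s)* Z(s) UA_τ(s)`.  Let `0 ≤ m ≤ k`, `j : ℕ`, and let `X₁, …, X_j`
(given by `Xs i 0` with derivatives `Xs i d`) be `m`-times continuously differentiable
operator families compactly supported in `(0,1)`.

Then the quantity
`A_j(X₁,…,X_j) = Q₀ ∫₀¹ X₁[s₁] Q₀ ⋯ Q₀ ∫₀^{s_{j−1}} X_j[s_j] P₀ Ω_τ(s_j) P₀`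
is `O(1/τ^m)`: there is `C` (independent of `τ`) with `‖A_j‖ ≤ C/τ^m` for all `τ ≥ 1`. -/
theorem iterated_integrals_lemma
    {V : Type*} [NormedAddCommGroup V] [InnerProductSpace ℂ V] [FiniteDimensional ℂ V]
    (k m j : ℕ) (hk : 2 ≤ k) (hm : m ≤ k)
    (Hd Pd : ℕ → ℝ → V →L[ℂ] V)
    (bm bp : ℝ → ℝ) (g : ℝ) (hg : 0 < g)
    (hHsa : ∀ s ∈ Set.Icc (0:ℝ) 1, IsSelfAdjoint (Hd 0 s))
    (hHder : ∀ i < k, ∀ s ∈ Set.Icc (0:ℝ) 1, HasDerivAt (Hd i) (Hd (i+1) s) s)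
    (hHkc : ContinuousOn (Hd k) (Set.Icc (0:ℝ) 1))
    (hHsupp : tsupport (Hd 1) ⊆ Set.Ioo (0:ℝ) 1)
    (hPsa : ∀ s ∈ Set.Icc (0:ℝ) 1, IsSelfAdjoint (Pd 0 s))
    (hPidem : ∀ s ∈ Set.Icc (0:ℝ) 1, Pd 0 s ∘L Pd 0 s = Pd 0 s)
    (hPH : ∀ s ∈ Set.Icc (0:ℝ) 1, Hd 0 s ∘L Pd 0 s = Pd 0 s ∘L Hd 0 s)
    (hPder : ∀ i < k, ∀ s ∈ Set.Icc (0:ℝ) 1, HasDerivAt (Pd i) (Pd (i+1) s) s)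
    (hPkc : ContinuousOn (Pd k) (Set.Icc (0:ℝ) 1))
    (hband : ∀ s ∈ Set.Icc (0:ℝ) 1, ∀ (μ : ℝ) (v : V), v ≠ 0 → Pd 0 s v = v →
      Hd 0 s v = (μ : ℂ) • v → μ ∈ Set.Icc (bm s) (bp s))
    (hgap : ∀ s ∈ Set.Icc (0:ℝ) 1, ∀ (μ : ℝ) (v : V), v ≠ 0 → Pd 0 s v = 0 →
      Hd 0 s v = (μ : ℂ) • v → g ≤ Metric.infDist μ (Set.Icc (bm s) (bp s)))
    -- Schrödinger and adiabatic propagators: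
    (U UA : ℝ → ℝ → V →L[ℂ] V)
    (hU0 : ∀ τ > (0:ℝ), U τ 0 = 1) (hUA0 : ∀ τ > (0:ℝ), UA τ 0 = 1)
    (hUunitary : ∀ τ > (0:ℝ), ∀ s ∈ Set.Icc (0:ℝ) 1,
      ContinuousLinearMap.adjoint (U τ s) ∘L U τ s = 1 ∧
      U τ s ∘L ContinuousLinearMap.adjoint (U τ s) = 1)
    (hUAunitary : ∀ τ > (0:ℝ), ∀ s ∈ Set.Icc (0:ℝ) 1,
      ContinuousLinearMap.adjoint (UA τ s) ∘L UA τ s = 1 ∧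
      UA τ s ∘L ContinuousLinearMap.adjoint (UA τ s) = 1)
    (hUde : ∀ τ > (0:ℝ), ∀ s ∈ Set.Icc (0:ℝ) 1,
      HasDerivAt (U τ) ((-(Complex.I * (τ : ℂ))) • (Hd 0 s ∘L U τ s)) s)
    (hUAde : ∀ τ > (0:ℝ), ∀ s ∈ Set.Icc (0:ℝ) 1,
      HasDerivAt (UA τ)
        (((-(Complex.I * (τ : ℂ))) • Hd 0 s + (Pd 1 s ∘L Pd 0 s - Pd 0 s ∘L Pd 1 s))
          ∘L UA τ s) s)
    -- the families `X₁, …, X_j`, `m`-times continuously differentiable,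
    -- compactly supported in `(0,1)`:
    (Xs : Fin j → ℕ → ℝ → V →L[ℂ] V)
    (hXder : ∀ i, ∀ d < m, ∀ s ∈ Set.Icc (0:ℝ) 1, HasDerivAt (Xs i d) (Xs i (d+1) s) s)
    (hXc : ∀ i, ContinuousOn (Xs i m) (Set.Icc (0:ℝ) 1))
    (hXsupp : ∀ i, tsupport (Xs i 0) ⊆ Set.Ioo (0:ℝ) 1) :
    ∃ C > (0:ℝ), ∀ τ ≥ (1:ℝ),
      ‖((1 : V →L[ℂ] V) - Pd 0 0) ∘L
        nestedIter
          (fun t => Pd 0 0 ∘L (ContinuousLinearMap.adjoint (UA τ t) ∘L U τ t) ∘L Pd 0 0)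
          ((1 : V →L[ℂ] V) - Pd 0 0)
          (List.ofFn (fun i => fun t =>
            ContinuousLinearMap.adjoint (UA τ t) ∘L Xs i 0 t ∘L UA τ t))
          1‖ ≤ C / τ ^ m := by
  obtain ⟨k, rfl⟩ : ∃ k', k = k' + 1 := ⟨k - 1, by omega⟩
  have hsub := Set.Ioo_subset_Icc_self (a := (0:ℝ)) (b := 1)
  have hH : ContDiffOn ℝ ((k+1 : ℕ) : WithTop ℕ∞) (Hd 0) (Set.Ioo (0:ℝ) 1) :=
    contDiffOn_of_chain (k+1) Hd hHder hHkc
  have hP : ContDiffOn ℝ ((k+1 : ℕ) : WithTop ℕ∞) (Pd 0) (Set.Ioo (0:ℝ) 1) :=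
    contDiffOn_of_chain (k+1) Pd hPder hPkc
  obtain ⟨K, hKe, hS⟩ := static_setup k Hd Pd bm bp g hg hHsa hHder hHkc hHsupp hPsa hPidem hPH
    hPder hPkc hband hgap
  have hbij : ∀ s ∈ Set.Ioo (0:ℝ) 1, Function.Bijective (sylvT (Hd 0 s) (Pd 0 s)) := fun s hs =>
    sylvT_bij hg (hHsa s (hsub hs)) (hPidem s (hsub hs)) (hPH s (hsub hs))
      (hband s (hsub hs)) (hgap s (hsub hs))
  have hEvo : ∀ τ ≥ (1:ℝ), AEvo (Hd 0) K (U τ) (UA τ) τ := by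
    intro τ hτ
    have hτ0 : τ > 0 := by linarith
    refine ⟨fun s hs => (hUAde τ hτ0 s hs).continuousAt.continuousWithinAt,
      fun s hs => (hUde τ hτ0 s hs).continuousAt.continuousWithinAt,
      fun s hs => (hUAunitary τ hτ0 s hs).1, fun s hs => (hUAunitary τ hτ0 s hs).2,
      fun s hs => (hUunitary τ hτ0 s hs).1, fun s hs => ?_,
      fun s hs => hUde τ hτ0 s (hsub hs), hUA0 τ hτ0, hU0 τ hτ0⟩
    rw [hKe s hs]
    exact hUAde τ hτ0 s (hsub hs)
  have hgood : ∀ Y ∈ List.ofFn (fun i => Xs i 0), AGood m Y := by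
    intro Y hY
    obtain ⟨i, rfl⟩ := (List.mem_ofFn' _ _).1 hY
    exact AGood.of_contDiffOn (contDiffOn_of_chain m (Xs i) (hXder i) (hXc i)) (hXsupp i)
  have hlist : ∀ τ : ℝ, List.ofFn (fun i => fun t =>
            ContinuousLinearMap.adjoint (UA τ t) ∘L Xs i 0 t ∘L UA τ t) =
      (List.ofFn (fun i => Xs i 0)).map (aD (UA τ)) := by
    intro τ
    rw [List.map_ofFn]
    rfl
  have hfun : ∀ τ : ℝ, (fun t => Pd 0 0 ∘L (ContinuousLinearMap.adjoint (UA τ t) ∘L U τ t)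
      ∘L Pd 0 0) = aB (Pd 0) (U τ) (UA τ) := fun τ => rfl
  simp only [hlist, hfun]
  generalize List.ofFn (fun i => Xs i 0) = L at hgood
  rcases List.eq_nil_or_concat L with rfl | ⟨L', X, rfl⟩
  · refine ⟨1, one_pos, fun τ hτ => ?_⟩
    have h0 : ((1 : V →L[ℂ] V) - Pd 0 0) * Pd 0 0 = 0 := by
      rw [sub_mul, one_mul]
      exact sub_eq_zero.2 (hPidem 0 (by simp)).symm
    have h1 : ((1 : V →L[ℂ] V) - Pd 0 0) ∘L nestedIter (aB (Pd 0) (U τ) (UA τ))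
        ((1 : V →L[ℂ] V) - Pd 0 0) (List.map (aD (UA τ)) []) 1 = 0 := by
      change ((1 : V →L[ℂ] V) - Pd 0 0) * (Pd 0 0 * _) = 0
      rw [← mul_assoc, h0, zero_mul]
    rw [h1, norm_zero]
    positivity
  · obtain ⟨C, hC, h⟩ := main_claim hS hH hP hbij m hm L'.reverse X
      (fun Y hY => hgood Y (by simp at hY ⊢; exact Or.inl hY)) (hgood X (by simp))
    refine ⟨C + 1, by positivity, fun τ hτ => ?_⟩
    have h1 := h τ hτ (U τ) (UA τ) (hEvo τ hτ)
    have h2 := aM_nested (1 - Pd 0 0) (aB (Pd 0) (U τ) (UA τ)) (L'.reverse.map (aD (UA τ)))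
      (aD (UA τ) X) []
    have h3 : nestedIter (aB (Pd 0) (U τ) (UA τ)) (1 - Pd 0 0) [aD (UA τ) X] =
        fun s => ∫ t in (0:ℝ)..s, aD (UA τ) X t * aB (Pd 0) (U τ) (UA τ) t := by
      funext s
      simp only [nestedIter]
      rfl
    rw [h3] at h2
    have h4 : (L'.reverse.map (aD (UA τ))).reverse ++ [aD (UA τ) X] =
        (L'.concat X).map (aD (UA τ)) := by simp
    rw [h4] at h2
    have h5 : ‖((1 : V →L[ℂ] V) - Pd 0 0) * nestedIter (aB (Pd 0) (U τ) (UA τ))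
        ((1 : V →L[ℂ] V) - Pd 0 0) ((L'.concat X).map (aD (UA τ))) 1‖ ≤ C / τ ^ m := by
      rw [← h2]; exact h1
    refine le_trans h5 ?_
    have : (0:ℝ) < τ ^ m := by positivity
    gcongr
    linarith
end

section
/- Second resolvent-integral identity (Lemma 6, second identity): For any linear operators A, B on V, (2πi)^{−1} ∮_Γ (H − z)^{−1} A (H − z)^{−1} B (H − z)^{−1} dz = (P − Q) ( Ã B̃ + (A B̃)~ − (Ã B)~ ), where for an operator X, X̃ := (2πi)^{−1} ∮_Γ (H − z)^{−1} X (H − z)^{−1} dz. -/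
open Complex Metric in
/-- The normalised scalar circle integral of the product of three scalar resolvents. -/
theorem sri_scalar (c : ℂ) (r : ℝ) (hr : 0 < r) (F : ℂ → ℂ) (T : ℂ → ℂ → ℂ) (U : ℂ → ℂ → ℂ → ℂ)
    (hF : ∀ a, F a = (2 * (Real.pi : ℂ) * I)⁻¹ * circleIntegral (fun z => (a - z)⁻¹) c r)
    (hT : ∀ a b, T a b = (2 * (Real.pi : ℂ) * I)⁻¹ *
      circleIntegral (fun z => (a - z)⁻¹ * (b - z)⁻¹) c r)
    (hU : ∀ a b d, U a b d = (2 * (Real.pi : ℂ) * I)⁻¹ *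
      circleIntegral (fun z => (a - z)⁻¹ * (b - z)⁻¹ * (d - z)⁻¹) c r)
    (a b d : ℂ) (ha : ‖a - c‖ ≠ r) (hb : ‖b - c‖ ≠ r) (hd : ‖d - c‖ ≠ r) :
    U a b d = (-2 * F a - 1) * (T a b * T b d + T a d * T b d - T a d * T a b) := by
  have h2 : (2 * (Real.pi : ℂ) * I) ≠ 0 := Complex.two_pi_I_ne_zero
  have hne : ∀ a : ℂ, ‖a - c‖ ≠ r → ∀ z ∈ sphere c r, a - z ≠ 0 := by
    intro a ha z hz h
    rw [sub_eq_zero] at h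
    subst h
    exact ha (mem_sphere_iff_norm.1 hz)
  have hcont : ∀ a : ℂ, ‖a - c‖ ≠ r → ContinuousOn (fun z => (a - z)⁻¹) (sphere c r) := by
    intro a ha
    exact ContinuousOn.inv₀ (by fun_prop) (hne a ha)
  have hF01 : ∀ a, ‖a - c‖ ≠ r → F a = 0 ∨ F a = -1 := by
    intro a ha
    rcases lt_or_gt_of_ne ha with h | h
    · right
      have h1 := circleIntegral.integral_sub_inv_of_mem_ball (mem_ball_iff_norm.2 h)
      have h3 : (fun z => (a - z)⁻¹) = fun z => (-1 : ℂ) * (z - a)⁻¹ := by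
        funext z
        rw [← neg_sub z a, inv_neg]; ring
      rw [hF, h3, circleIntegral.integral_const_mul, h1]
      field_simp
    · left
      have hz : ∀ z ∈ closedBall c r, a - z ≠ 0 := by
        intro z hz h0
        rw [sub_eq_zero] at h0
        subst h0
        exact absurd (mem_closedBall_iff_norm.1 hz) (not_le.2 h)
      rw [hF, Complex.circleIntegral_eq_zero_of_differentiable_on_off_countable hr.le
        Set.countable_empty, mul_zero]
      · exact ContinuousOn.inv₀ (by fun_prop) hz
      · intro z hz'
        exact DifferentiableAt.inv (by fun_prop) (hz z (ball_subset_closedBall hz'.1))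
  have hTT : ∀ a, T a a = 0 := by
    intro a
    have := circleIntegral.integral_sub_zpow_of_ne (n := -2) (by norm_num) c a r
    have h3 : (fun z => (a - z)⁻¹ * (a - z)⁻¹) = fun z => (z - a) ^ (-2 : ℤ) := by
      funext z
      rw [← neg_sub z a, inv_neg, zpow_neg]
      norm_cast
      rw [← inv_pow]; ring
    rw [hT, h3, this, mul_zero]
  have hUU : ∀ a, U a a a = 0 := by
    intro a
    have := circleIntegral.integral_sub_zpow_of_ne (n := -3) (by norm_num) c a r
    have h3 : (fun z => (a - z)⁻¹ * (a - z)⁻¹ * (a - z)⁻¹) =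
        fun z => (-1 : ℂ) * (z - a) ^ (-3 : ℤ) := by
      funext z
      have h4 : (z - a) ^ (-3 : ℤ) = ((z - a)⁻¹) ^ 3 := by
        rw [zpow_neg, inv_pow]; norm_cast
      rw [h4, ← neg_sub z a, inv_neg]; ring
    rw [hU, h3, circleIntegral.integral_const_mul, this, mul_zero, mul_zero]
  have hT1 : ∀ a b, ‖a - c‖ ≠ r → ‖b - c‖ ≠ r → T a b * (b - a) = F a - F b := by
    intro a b ha hb
    rw [hT, hF, hF, ← mul_sub, ← circleIntegral.integral_sub
      ((hcont a ha).circleIntegrable hr.le) ((hcont b hb).circleIntegrable hr.le),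
      mul_assoc, mul_comm _ (b - a), ← circleIntegral.integral_const_mul]
    congr 1
    refine circleIntegral.integral_congr hr.le fun z hz => ?_
    have h1 := hne a ha z hz
    have h2 := hne b hb z hz
    field_simp
    ring
  have hU1 : ∀ a b d, ‖a - c‖ ≠ r → ‖b - c‖ ≠ r → ‖d - c‖ ≠ r →
      U a b d * (b - a) = T a d - T b d := by
    intro a b d ha hb hd
    rw [hU, hT, hT, ← mul_sub, ← circleIntegral.integral_sub
      (f := fun z => (a - z)⁻¹ * (d - z)⁻¹) (g := fun z => (b - z)⁻¹ * (d - z)⁻¹)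
      (((hcont a ha).mul (hcont d hd)).circleIntegrable hr.le)
      (((hcont b hb).mul (hcont d hd)).circleIntegrable hr.le),
      mul_assoc, mul_comm _ (b - a), ← circleIntegral.integral_const_mul]
    congr 1
    refine circleIntegral.integral_congr hr.le fun z hz => ?_
    have h1 := hne a ha z hz
    have h2 := hne b hb z hz
    have h3 := hne d hd z hz
    field_simp
    ring
  have hUs : ∀ a b d, U a b d = U a d b := by
    intro a b d
    rw [hU, hU]
    congr 2
    funext z
    ring
  have hTs : ∀ a b, T a b = T b a := by
    intro a b
    rw [hT, hT]
    congr 2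
    funext z
    ring
  have hTd : ∀ a b, ‖a - c‖ ≠ r → ‖b - c‖ ≠ r → a ≠ b → T a b = (F a - F b) / (b - a) := by
    intro a b ha hb hab
    rw [eq_div_iff (sub_ne_zero.2 hab.symm), hT1 a b ha hb]
  have hUd : ∀ a b d, ‖a - c‖ ≠ r → ‖b - c‖ ≠ r → ‖d - c‖ ≠ r → a ≠ b →
      U a b d = (T a d - T b d) / (b - a) := by
    intro a b d ha hb hd hab
    rw [eq_div_iff (sub_ne_zero.2 hab.symm), hU1 a b d ha hb hd]
  by_cases hab : a = b
  · subst hab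
    by_cases had : a = d
    · subst had
      simp [hUU, hTT]
    · have h0 : d - a ≠ 0 := sub_ne_zero.2 (Ne.symm had)
      rw [hUs, hUd a d a ha hd ha had, hTs d a, hTT, hTd a d ha hd had]
      rcases hF01 a ha with h1 | h1 <;> rcases hF01 d hd with h3 | h3 <;> rw [h1, h3] <;>
        field_simp <;> ring
  · have h0 : b - a ≠ 0 := sub_ne_zero.2 (Ne.symm hab)
    rw [hUd a b d ha hb hd hab, hTd a b ha hb hab]
    by_cases had : a = d
    · subst had
      rw [hTs b a, hTT, hTd a b ha hb hab]
      rcases hF01 a ha with h1 | h1 <;> rcases hF01 b hb with h3 | h3 <;> rw [h1, h3] <;>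
        field_simp <;> ring
    · have h1 : d - a ≠ 0 := sub_ne_zero.2 (Ne.symm had)
      rw [hTd a d ha hd had]
      by_cases hbd : b = d
      · subst hbd
        rw [hTT]
        rcases hF01 a ha with h1 | h1 <;> rcases hF01 b hb with h3 | h3 <;> rw [h1, h3] <;>
          field_simp <;> ring
      · have h2 : d - b ≠ 0 := sub_ne_zero.2 (Ne.symm hbd)
        rw [hTd b d hb hd hbd]
        rcases hF01 a ha with h1 | h1 <;> rcases hF01 b hb with h3 | h3 <;>
          rcases hF01 d hd with h4 | h4 <;> rw [h1, h3, h4] <;>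
          field_simp <;> ring

/-- Continuous linear functionals commute with circle integrals. -/
theorem sri_comp_comm {E : Type*} [NormedAddCommGroup E] [NormedSpace ℂ E] [CompleteSpace E]
    (φ : E →L[ℂ] ℂ) (f : ℂ → E) (c : ℂ) (r : ℝ) (hf : CircleIntegrable f c r) :
    φ (circleIntegral f c r) = circleIntegral (fun z => φ (f z)) c r := by
  unfold circleIntegral
  rw [← ContinuousLinearMap.intervalIntegral_comp_comm _ hf.out]
  simp

/-- **Second resolvent-integral identity (Lemma 6, second identity).**

`H` is a self-adjoint operator on a finite-dimensional complex inner product space,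
`lam 1, …, lam m` some of its eigenvalues, `P` the orthogonal projection onto the sum of
the corresponding eigenspaces, `Q := 1 − P`, and `Γ` (a positively oriented circle of
center `c`, radius `r`) encloses exactly these eigenvalues and no other point of the
spectrum, so that `P = −(2πi)⁻¹ ∮_Γ (H−z)⁻¹ dz`.  Writing
`X̃ := (2πi)⁻¹ ∮_Γ (H−z)⁻¹ X (H−z)⁻¹ dz`, for all operators `A`, `B`:
`(2πi)⁻¹ ∮_Γ (H−z)⁻¹ A (H−z)⁻¹ B (H−z)⁻¹ dz = (P−Q)(Ã B̃ + (A B̃)~ − (Ã B)~)`. -/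
theorem second_resolvent_integral_identity
    {V : Type*} [NormedAddCommGroup V] [InnerProductSpace ℂ V] [FiniteDimensional ℂ V]
    (H : V →L[ℂ] V) (hH : IsSelfAdjoint H)
    (m : ℕ) (lam : Fin m → ℝ)
    (hlam : ∀ j, Module.End.HasEigenvalue (H : V →ₗ[ℂ] V) (lam j : ℂ))
    (P : V →L[ℂ] V)
    (hPsa : IsSelfAdjoint P) (hPidem : P ∘L P = P)
    (hPrange : ∀ v : V, P v = v ↔
      v ∈ ⨆ j : Fin m, Module.End.eigenspace (H : V →ₗ[ℂ] V) (lam j : ℂ))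
    (c : ℂ) (r : ℝ) (hr : 0 < r)
    (hin : ∀ j, ‖(lam j : ℂ) - c‖ < r)
    (hout : ∀ μ ∈ spectrum ℂ H, (∀ j, μ ≠ (lam j : ℂ)) → r < ‖μ - c‖)
    (hPint : P = (-(2 * (Real.pi : ℂ) * Complex.I)⁻¹) •
      circleIntegral (fun z => Ring.inverse (H - z • (1 : V →L[ℂ] V))) c r)
    (A B : V →L[ℂ] V) :
    let Q : V →L[ℂ] V := 1 - P
    let tw : (V →L[ℂ] V) → V →L[ℂ] V := fun X =>
      (2 * (Real.pi : ℂ) * Complex.I)⁻¹ •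
        circleIntegral (fun z =>
          Ring.inverse (H - z • (1 : V →L[ℂ] V)) ∘L X ∘L
            Ring.inverse (H - z • (1 : V →L[ℂ] V))) c r
    (2 * (Real.pi : ℂ) * Complex.I)⁻¹ •
        circleIntegral (fun z =>
          Ring.inverse (H - z • (1 : V →L[ℂ] V)) ∘L A ∘L
            Ring.inverse (H - z • (1 : V →L[ℂ] V)) ∘L B ∘L
              Ring.inverse (H - z • (1 : V →L[ℂ] V))) c r
      = (P - Q) ∘L (tw A ∘L tw B + tw (A ∘L tw B) - tw (tw A ∘L B)) := by
  intro Q tw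
  have : CompleteSpace V := FiniteDimensional.complete ℂ V
  have hsym : (H : V →ₗ[ℂ] V).IsSymmetric :=
    ContinuousLinearMap.isSelfAdjoint_iff_isSymmetric.1 hH
  let b := hsym.eigenvectorBasis rfl
  let μ : Fin (Module.finrank ℂ V) → ℂ := fun i => (hsym.eigenvalues rfl i : ℂ)
  have hb : ∀ i, H (b i) = μ i • b i := fun i => hsym.apply_eigenvectorBasis rfl i
  have hspec : ∀ z ∈ spectrum ℂ H, ‖z - c‖ ≠ r := by
    intro z hz
    by_cases h : ∀ j, z ≠ (lam j : ℂ)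
    · exact (hout z hz h).ne'
    · push Not at h
      obtain ⟨j, rfl⟩ := h
      exact (hin j).ne
  have hunit : ∀ z : ℂ, ‖z - c‖ = r → IsUnit (H - z • (1 : V →L[ℂ] V)) := by
    intro z hz
    by_contra h
    refine hspec z ?_ hz
    rw [spectrum.mem_iff]
    intro h'
    apply h
    rw [← neg_sub, IsUnit.neg_iff, ← Algebra.algebraMap_eq_smul_one]
    exact h'
  have hμ : ∀ i, ‖μ i - c‖ ≠ r := by
    intro i h
    have hu := hunit _ h
    have h1 := Ring.inverse_mul_cancel _ hu
    have h2 := congrArg (fun X : V →L[ℂ] V => X (b i)) h1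
    simp [hb] at h2
    exact b.orthonormal.ne_zero i h2.symm
  have hμne : ∀ i (z : ℂ), ‖z - c‖ = r → μ i - z ≠ 0 := by
    intro i z hz h
    rw [sub_eq_zero] at h
    exact hμ i (h ▸ hz)
  have hRr : ∀ (z : ℂ), ‖z - c‖ = r → ∀ i,
      Ring.inverse (H - z • (1 : V →L[ℂ] V)) (b i) = (μ i - z)⁻¹ • b i := by
    intro z hz i
    have h1 := Ring.inverse_mul_cancel _ (hunit z hz)
    have h2 := congrArg (fun X : V →L[ℂ] V => X (b i)) h1
    have h3 : (H - z • (1 : V →L[ℂ] V)) (b i) = (μ i - z) • b i := by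
      simp [hb, sub_smul]
    simp only [mul_apply_eq_comp, h3, map_smul] at h2
    rw [eq_inv_smul_iff₀ (hμne i z hz), h2]
    rfl
  have hRl : ∀ (z : ℂ), ‖z - c‖ = r → ∀ i (v : V),
      inner ℂ (b i) (Ring.inverse (H - z • (1 : V →L[ℂ] V)) v) = (μ i - z)⁻¹ * inner ℂ (b i) v := by
    intro z hz i v
    have h1 := Ring.mul_inverse_cancel _ (hunit z hz)
    have h2 := congrArg (fun X : V →L[ℂ] V => X v) h1
    have h3 : ∀ w, inner ℂ (b i) ((H - z • (1 : V →L[ℂ] V)) w) = (μ i - z) * inner ℂ (b i) w := by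
      intro w
      have h4 : inner ℂ (b i) (H w) = μ i * inner ℂ (b i) w := by
        have h5 := hsym (b i) w
        simp only [ContinuousLinearMap.coe_coe, hb, inner_smul_left] at h5
        rw [← h5]
        simp [μ]
      simp [inner_sub_right, inner_smul_right, h4, sub_mul]
    have h6 := h3 (Ring.inverse (H - z • (1 : V →L[ℂ] V)) v)
    simp only [mul_apply_eq_comp, one_apply_eq_self] at h2
    rw [h2] at h6
    rw [h6, inv_mul_cancel_left₀ (hμne i z hz)]
  have hRc : ContinuousOn (fun z : ℂ => Ring.inverse (H - z • (1 : V →L[ℂ] V)))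
      (Metric.sphere c r) := by
    intro z hz
    obtain ⟨u, hu⟩ := hunit z (mem_sphere_iff_norm.1 hz)
    refine ContinuousAt.continuousWithinAt ?_
    refine ContinuousAt.comp (g := Ring.inverse) (f := fun z : ℂ => H - z • (1 : V →L[ℂ] V)) ?_
      (by fun_prop)
    rw [← hu]
    exact NormedRing.inverse_continuousAt u
  let φ : Fin (Module.finrank ℂ V) → Fin (Module.finrank ℂ V) → (V →L[ℂ] V) →L[ℂ] ℂ := fun i k =>
    (innerSL ℂ (b i)) ∘L (ContinuousLinearMap.apply ℂ V (b k))
  have hφ : ∀ i k X, φ i k X = inner ℂ (b i) (X (b k)) := fun i k X => rfl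
  have hφext : ∀ X Y, (∀ i k, φ i k X = φ i k Y) → X = Y := by
    intro X Y h
    have h1 : (X : V →ₗ[ℂ] V) = Y := by
      refine b.toBasis.ext fun k => ?_
      apply b.repr.injective
      ext i
      simpa [b.repr_apply_apply, hφ] using h i k
    exact ContinuousLinearMap.coe_injective h1
  have hφmul : ∀ i k (X Y : V →L[ℂ] V), φ i k (X ∘L Y) = ∑ j, φ i j X * φ j k Y := by
    intro i k X Y
    simp only [hφ, ContinuousLinearMap.comp_apply]
    conv_lhs => rw [← b.sum_repr' (Y (b k))]
    simp only [map_sum, map_smul, inner_sum, inner_smul_right]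
    exact Finset.sum_congr rfl fun j _ => mul_comm _ _
  let F : ℂ → ℂ := fun a => (2 * (Real.pi : ℂ) * Complex.I)⁻¹ *
    circleIntegral (fun z => (a - z)⁻¹) c r
  let T : ℂ → ℂ → ℂ := fun a b => (2 * (Real.pi : ℂ) * Complex.I)⁻¹ *
    circleIntegral (fun z => (a - z)⁻¹ * (b - z)⁻¹) c r
  let U : ℂ → ℂ → ℂ → ℂ := fun a b d => (2 * (Real.pi : ℂ) * Complex.I)⁻¹ *
    circleIntegral (fun z => (a - z)⁻¹ * (b - z)⁻¹ * (d - z)⁻¹) c r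
  have hPc : ∀ i k, φ i k P = if i = k then -F (μ i) else 0 := by
    intro i k
    rw [hPint, map_smul, sri_comp_comm _ _ _ _ (hRc.circleIntegrable hr.le)]
    have h1 : circleIntegral (fun z => φ i k (Ring.inverse (H - z • (1 : V →L[ℂ] V)))) c r =
        circleIntegral (fun z => (if i = k then 1 else 0) * (μ i - z)⁻¹) c r := by
      refine circleIntegral.integral_congr hr.le fun z hz => ?_
      rw [hφ, hRl z (mem_sphere_iff_norm.1 hz), b.inner_eq_ite, mul_comm]
    rw [h1, circleIntegral.integral_const_mul]
    split_ifs <;> simp [F]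
  have htw : ∀ i k X, φ i k (tw X) = T (μ i) (μ k) * φ i k X := by
    intro i k X
    simp only [tw, T]
    rw [map_smul, sri_comp_comm _ _ _ _ (ContinuousOn.circleIntegrable hr.le
      (hRc.clm_comp (continuousOn_const.clm_comp hRc)))]
    have h1 : circleIntegral (fun z => φ i k (Ring.inverse (H - z • (1 : V →L[ℂ] V)) ∘L X ∘L
        Ring.inverse (H - z • (1 : V →L[ℂ] V)))) c r =
        circleIntegral (fun z => φ i k X * ((μ i - z)⁻¹ * (μ k - z)⁻¹)) c r := by
      refine circleIntegral.integral_congr hr.le fun z hz => ?_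
      have hz' := mem_sphere_iff_norm.1 hz
      simp only [hφ, ContinuousLinearMap.comp_apply]
      rw [hRl z hz', hRr z hz', map_smul, inner_smul_right]
      ring
    rw [h1, circleIntegral.integral_const_mul, smul_eq_mul]
    ring
  apply hφext
  intro i k
  have hL : φ i k ((2 * (Real.pi : ℂ) * Complex.I)⁻¹ •
        circleIntegral (fun z =>
          Ring.inverse (H - z • (1 : V →L[ℂ] V)) ∘L A ∘L
            Ring.inverse (H - z • (1 : V →L[ℂ] V)) ∘L B ∘L
              Ring.inverse (H - z • (1 : V →L[ℂ] V))) c r) =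
      ∑ j, U (μ i) (μ j) (μ k) * (φ i j A * φ j k B) := by
    have hc1 : ∀ i, ContinuousOn (fun z => (μ i - z)⁻¹) (Metric.sphere c r) := fun i =>
      ContinuousOn.inv₀ (by fun_prop) fun z hz => hμne i z (mem_sphere_iff_norm.1 hz)
    rw [map_smul, sri_comp_comm _ _ _ _ (ContinuousOn.circleIntegrable hr.le
      (hRc.clm_comp (continuousOn_const.clm_comp (hRc.clm_comp
        (continuousOn_const.clm_comp hRc)))))]
    have h1 : circleIntegral (fun z => φ i k (Ring.inverse (H - z • (1 : V →L[ℂ] V)) ∘L A ∘L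
        Ring.inverse (H - z • (1 : V →L[ℂ] V)) ∘L B ∘L
        Ring.inverse (H - z • (1 : V →L[ℂ] V)))) c r =
        circleIntegral (fun z => ∑ j, (φ i j A * φ j k B) *
          ((μ i - z)⁻¹ * (μ j - z)⁻¹ * (μ k - z)⁻¹)) c r := by
      refine circleIntegral.integral_congr hr.le fun z hz => ?_
      have hz' := mem_sphere_iff_norm.1 hz
      have h2 : φ i k (Ring.inverse (H - z • (1 : V →L[ℂ] V)) ∘L A ∘L
        Ring.inverse (H - z • (1 : V →L[ℂ] V)) ∘L B ∘L
        Ring.inverse (H - z • (1 : V →L[ℂ] V))) =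
          (μ i - z)⁻¹ * (μ k - z)⁻¹ *
            φ i k (A ∘L (Ring.inverse (H - z • (1 : V →L[ℂ] V)) ∘L B)) := by
        simp only [hφ, ContinuousLinearMap.comp_apply]
        rw [hRl z hz', hRr z hz']
        simp only [map_smul, inner_smul_right]
        ring
      rw [h2, hφmul, Finset.mul_sum]
      refine Finset.sum_congr rfl fun j _ => ?_
      have h3 : φ j k (Ring.inverse (H - z • (1 : V →L[ℂ] V)) ∘L B) =
          (μ j - z)⁻¹ * φ j k B := by
        simp only [hφ, ContinuousLinearMap.comp_apply]
        rw [hRl z hz']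
      rw [h3]
      ring
    rw [h1, circleIntegral.integral_fun_sum, smul_eq_mul, Finset.mul_sum]
    · refine Finset.sum_congr rfl fun j _ => ?_
      rw [circleIntegral.integral_const_mul]
      simp only [U]
      ring
    · intro j _
      exact ContinuousOn.circleIntegrable hr.le
        (continuousOn_const.mul (((hc1 i).mul (hc1 j)).mul (hc1 k)))
  have hPQ : ∀ j, φ i j (P - Q) = if i = j then -2 * F (μ i) - 1 else 0 := by
    intro j
    have h1 : φ i j (1 : V →L[ℂ] V) = if i = j then 1 else 0 := by
      rw [hφ, one_apply_eq_self, b.inner_eq_ite]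
    simp only [Q, map_sub, hPc, h1]
    split_ifs <;> ring
  rw [hL, hφmul]
  simp only [hPQ, ite_mul, zero_mul, Finset.sum_ite_eq, Finset.mem_univ, if_true]
  simp only [map_sub, map_add, htw, hφmul]
  rw [Finset.mul_sum, Finset.mul_sum, ← Finset.sum_add_distrib, ← Finset.sum_sub_distrib,
    Finset.mul_sum]
  refine Finset.sum_congr rfl fun j _ => ?_
  rw [sri_scalar c r hr F T U (fun _ => rfl) (fun _ _ => rfl) (fun _ _ _ => rfl)
    (μ i) (μ j) (μ k) (hμ i) (hμ j) (hμ k)]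
  ring
end

section
/- Adiabatic Grover search with linear interpolation (Example, claim 1): Consider H(s) := (1−s)H₀ + sH₁ on ℂ^{2ⁿ}, with P(s) the orthogonal projection onto the (nondegenerate) ground state of H(s), Q(s) := 1 − P(s), and g_min := 2^{−n/2}. Then there exists a constant C > 0, independent of n and τ, such that for all n ≥ 1 and all τ > 0, the wave operator satisfies ‖Q(0) Ω_τ(1) P(0)‖ ≤ C / (τ g_min²). -/
set_option linter.unusedSimpArgs false
namespace Grover
variable {A : Type*} [CStarAlgebra A]

lemma proj_norm_le {x : A} (h1 : star x = x) (h2 : x * x = x) : ‖x‖ ≤ 1 := by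
  have h := CStarRing.norm_star_mul_self (x := x)
  rw [h1, h2] at h
  by_contra hc
  push Not at hc
  nlinarith

lemma isom_norm_le {x : A} (h : star x * x = 1) : ‖x‖ ≤ 1 := by
  have h' := CStarRing.norm_star_mul_self (x := x)
  rw [h] at h'
  have : ‖(1:A)‖ ≤ 1 := proj_norm_le (by simp) (by simp)
  nlinarith [norm_nonneg x]

lemma conj_deriv {U X : ℝ → A} {G X' : A} {s : ℝ} (hU : HasDerivAt U (G * U s) s)
    (hG : star G = -G) (hX : HasDerivAt X X' s) :
    HasDerivAt (fun t => star (U t) * X t * U t)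
      (star (U s) * (X' + (X s * G - G * X s)) * U s) s := by
  have h := (hU.star.mul hX).mul hU
  refine h.congr_deriv ?_
  simp only [Pi.mul_apply]
  rw [star_mul, hG]
  noncomm_ring

/-- the gap -/
noncomputable def gap (d s : ℝ) : ℝ := Real.sqrt (1 - 4 * (1 - d) * s * (1 - s))

lemma gap_arg {d s : ℝ} (hd1 : d < 1) : d ≤ 1 - 4 * (1 - d) * s * (1 - s) := by
  nlinarith [mul_nonneg (sub_nonneg.2 hd1.le) (sq_nonneg (1 - 2 * s))]

lemma gap_sq {d : ℝ} (s : ℝ) (hd0 : 0 < d) (hd1 : d < 1) :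
    gap d s ^ 2 = 1 - 4 * (1 - d) * s * (1 - s) :=
  Real.sq_sqrt (hd0.le.trans (gap_arg hd1))

lemma gap_pos {d : ℝ} (s : ℝ) (hd0 : 0 < d) (hd1 : d < 1) : 0 < gap d s :=
  Real.sqrt_pos.2 (hd0.trans_le (gap_arg hd1))

lemma gap_deriv {d : ℝ} (s : ℝ) (hd0 : 0 < d) (hd1 : d < 1) :
    HasDerivAt (gap d) (-2 * (1 - d) * (1 - 2 * s) / gap d s) s := by
  have h : HasDerivAt (fun s : ℝ => 1 - 4 * (1 - d) * s * (1 - s))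
      (-4 * (1 - d) * (1 - 2 * s)) s := by
    have h1 := (((hasDerivAt_id s).const_mul (4 * (1 - d))).mul
      ((hasDerivAt_id s).const_sub 1)).const_sub 1
    refine h1.congr_deriv ?_
    simp; ring
  have := h.sqrt (hd0.trans_le (gap_arg hd1)).ne'
  refine this.congr_deriv ?_
  have hg := gap_pos s hd0 hd1
  change _ / (2 * gap d s) = _
  field_simp; ring

/-- top eigenprojection of `(1-s) p + s q` -/
noncomputable def Pe (p q : A) (d s : ℝ) : A :=
  (gap d s)⁻¹ • ((1 - s) • p + s • q - (1 / 2 * (1 - d)⁻¹) • (p + q - p * q - q * p))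
    + (1 / 2 * (1 - d)⁻¹) • (p + q - p * q - q * p)

lemma inv_gap_deriv {d : ℝ} (s : ℝ) (hd0 : 0 < d) (hd1 : d < 1) :
    HasDerivAt (fun s => (gap d s)⁻¹) (2 * (1 - d) * (1 - 2 * s) / gap d s ^ 3) s := by
  have hg := gap_pos s hd0 hd1
  refine ((gap_deriv s hd0 hd1).inv hg.ne').congr_deriv ?_
  field_simp

lemma inv_gap3_deriv {d : ℝ} (s : ℝ) (hd0 : 0 < d) (hd1 : d < 1) :
    HasDerivAt (fun s => (gap d s)⁻¹ ^ 3) (6 * (1 - d) * (1 - 2 * s) / gap d s ^ 5) s := by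
  have hg := gap_pos s hd0 hd1
  refine ((inv_gap_deriv s hd0 hd1).pow 3).congr_deriv ?_
  norm_num
  field_simp
  ring

lemma Pe_deriv (p q : A) {d : ℝ} (s : ℝ) (hd0 : 0 < d) (hd1 : d < 1) :
    HasDerivAt (Pe p q d) ((2 * (1 - d) * (1 - 2 * s) / gap d s ^ 3) •
      ((1 - s) • p + s • q - (1 / 2 * (1 - d)⁻¹) • (p + q - p * q - q * p))
      + (gap d s)⁻¹ • (q - p)) s := by
  have h1 : HasDerivAt (fun s : ℝ => (1 - s) • p + s • q -
      (1 / 2 * (1 - d)⁻¹) • (p + q - p * q - q * p)) (q - p) s := by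
    have := ((((hasDerivAt_id s).const_sub 1).smul_const p).add
      ((hasDerivAt_id s).smul_const q)).sub_const
      ((1 / 2 * (1 - d)⁻¹) • (p + q - p * q - q * p))
    refine this.congr_deriv ?_
    simp; abel
  have := ((inv_gap_deriv s hd0 hd1).smul h1).add_const
    ((1 / 2 * (1 - d)⁻¹) • (p + q - p * q - q * p))
  refine this.congr_deriv ?_
  abel

section alg
variable {p q : A} {d : ℝ}

/-- two projections with constant overlap -/
structure Rel (p q : A) (d : ℝ) : Prop where
  sp : star p = p
  sq : star q = q
  pp : p * p = p
  qq : q * q = q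
  pqp : p * (q * p) = d • p
  qpq : q * (p * q) = d • q

lemma Rel.ppx (h : Rel p q d) (x : A) : p * (p * x) = p * x := by rw [← mul_assoc, h.pp]
lemma Rel.qqx (h : Rel p q d) (x : A) : q * (q * x) = q * x := by rw [← mul_assoc, h.qq]

/-- The Hamiltonian -/
noncomputable def Ham (p q : A) (s : ℝ) : A := (1 - s) • (1 - p) + s • (1 - q)

lemma star_Ham (h : Rel p q d) (s : ℝ) : star (Ham p q s) = Ham p q s := by
  simp [Ham, h.sp, h.sq]

lemma star_Pe (h : Rel p q d) (s : ℝ) : star (Pe p q d s) = Pe p q d s := by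
  simp [Pe, h.sp, h.sq]
  module

lemma comm_Z (h : Rel p q d) (s : ℝ) (hd0 : 0 < d) (hd1 : d < 1) :
    Ham p q s * ((gap d s)⁻¹ ^ 3 • (q * p - p * q)) -
      ((gap d s)⁻¹ ^ 3 • (q * p - p * q)) * Ham p q s =
    (2 * (1 - d) * (1 - 2 * s) / gap d s ^ 3) •
      ((1 - s) • p + s • q - (1 / 2 * (1 - d)⁻¹) • (p + q - p * q - q * p))
      + (gap d s)⁻¹ • (q - p) := by
  have hg := gap_pos s hd0 hd1
  have hg2 := gap_sq s hd0 hd1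
  have hd : 1 - d ≠ 0 := by linarith
  simp only [Ham, mul_add, add_mul, mul_sub, sub_mul, smul_mul_assoc, mul_smul_comm, mul_assoc,
    h.pp, h.qq, h.ppx, h.qqx, h.pqp, h.qpq, mul_one, one_mul, smul_sub, smul_add]
  generalize gap d s = g at *
  match_scalars
  all_goals field_simp
  all_goals ring_nf
  all_goals try rw [hg2]
  all_goals ring_nf

lemma Ham_Pe (h : Rel p q d) (s : ℝ) (hd0 : 0 < d) (hd1 : d < 1) :
    Ham p q s * Pe p q d s = ((1 - gap d s) / 2) • Pe p q d s := by
  have hg := gap_pos s hd0 hd1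
  have hg2 := gap_sq s hd0 hd1
  have hd : 1 - d ≠ 0 := by linarith
  simp only [Ham, Pe, mul_add, add_mul, mul_sub, sub_mul, smul_mul_assoc, mul_smul_comm, mul_assoc,
    h.pp, h.qq, h.ppx, h.qqx, h.pqp, h.qpq, mul_one, one_mul, smul_sub, smul_add]
  generalize gap d s = g at *
  match_scalars
  all_goals field_simp
  all_goals ring_nf
  all_goals try rw [hg2]
  all_goals ring_nf

lemma Pe_ne (h : Rel p q d) (hp : p ≠ 0) (hq : q ≠ 0) (s : ℝ) (hd0 : 0 < d) (hd1 : d < 1) :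
    Pe p q d s ≠ 0 := by
  intro h0
  have hg := gap_pos s hd0 hd1
  have hd : 1 - d ≠ 0 := by linarith
  have e1 : p * Pe p q d s * p = ((gap d s)⁻¹ * (1 - s + s * d - 1 / 2) + 1 / 2) • p := by
    simp only [Pe, mul_add, add_mul, mul_sub, sub_mul, smul_mul_assoc, mul_smul_comm, mul_assoc,
      h.pp, h.qq, h.ppx, h.qqx, h.pqp, h.qpq, mul_one, one_mul, smul_sub, smul_add]
    match_scalars
    field_simp
    ring
  have e2 : q * Pe p q d s * q = ((gap d s)⁻¹ * ((1 - s) * d + s - 1 / 2) + 1 / 2) • q := by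
    simp only [Pe, mul_add, add_mul, mul_sub, sub_mul, smul_mul_assoc, mul_smul_comm, mul_assoc,
      h.pp, h.qq, h.ppx, h.qqx, h.pqp, h.qpq, mul_one, one_mul, smul_sub, smul_add]
    match_scalars
    field_simp
    ring
  rw [h0, mul_zero, zero_mul] at e1 e2
  have f1 := (smul_eq_zero.1 e1.symm).resolve_right hp
  have f2 := (smul_eq_zero.1 e2.symm).resolve_right hq
  have : (gap d s)⁻¹ * d + 1 = 0 := by linear_combination f1 + f2
  have : 0 < (gap d s)⁻¹ * d := by positivity
  linarith

lemma P_eq (h : Rel p q d) (hp : p ≠ 0) (hq : q ≠ 0) (s : ℝ) (hd0 : 0 < d) (hd1 : d < 1)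
    {P : A} {E : ℝ} (hPs : star P = P) (hP0 : P ≠ 0) (hE : Ham p q s * P = E • P)
    (hfull : ∀ X : A, Ham p q s * X = E • X → P * X = X)
    (hmin : ∀ (m : ℝ) (X : A), X ≠ 0 → Ham p q s * X = m • X → E ≤ m) : P = Pe p q d s := by
  have hg := gap_pos s hd0 hd1
  have hg2 := gap_sq s hd0 hd1
  have hd : 1 - d ≠ 0 := by linarith
  have hEle := hmin _ _ (Pe_ne h hp hq s hd0 hd1) (Ham_Pe h s hd0 hd1)
  set M : A := (1 - s) • p + s • q with hM
  set R : A := (1 - d)⁻¹ • (p + q - p * q - q * p) with hR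
  have hHM : Ham p q s = 1 - M := by simp only [Ham, hM]; module
  have hRM : R * M = M := by
    simp only [hM, hR, mul_add, add_mul, mul_sub, sub_mul, smul_mul_assoc, mul_smul_comm, mul_assoc,
      h.pp, h.qq, h.ppx, h.qqx, h.pqp, h.qpq, mul_one, one_mul, smul_sub, smul_add]
    match_scalars
    all_goals field_simp
    all_goals ring
  have hMM : M * M = M - ((1 - gap d s ^ 2) / 4) • R := by
    rw [hg2]
    simp only [hM, hR, mul_add, add_mul, mul_sub, sub_mul, smul_mul_assoc, mul_smul_comm, mul_assoc,
      h.pp, h.qq, h.ppx, h.qqx, h.pqp, h.qpq, mul_one, one_mul, smul_sub, smul_add]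
    match_scalars
    all_goals field_simp
    all_goals ring
  have hMP : M * P = (1 - E) • P := by
    have : M = 1 - Ham p q s := by rw [hHM]; abel
    rw [this, sub_mul, hE, one_mul]; module
  have hm : 0 < 1 - E := by linarith
  have hRP : R * P = P := by
    have h1 : R * (M * P) = M * P := by rw [← mul_assoc, hRM]
    rw [hMP, mul_smul_comm] at h1
    exact smul_right_injective A hm.ne' h1
  have h2 : ((1 - E) * (1 - E) - (1 - E) + (1 - gap d s ^ 2) / 4) • P = 0 := by
    have h1 : M * (M * P) = M * P - ((1 - gap d s ^ 2) / 4) • (R * P) := by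
      rw [← mul_assoc, hMM, sub_mul, smul_mul_assoc]
    rw [hMP, mul_smul_comm, hMP, hRP] at h1
    have h3 := sub_eq_zero.2 h1
    rw [← h3]; module
  have h3 := (smul_eq_zero.1 h2).resolve_right hP0
  have h4 : (1 - E - 1 / 2 - gap d s / 2) * (1 - E - 1 / 2 + gap d s / 2) = 0 := by
    linear_combination h3
  have h5 : 1 - E - 1 / 2 - gap d s / 2 = 0 := by
    rcases mul_eq_zero.1 h4 with h5 | h5
    · exact h5
    · linarith
  have hPe : Pe p q d s = (gap d s)⁻¹ • (M - (1 / 2 : ℝ) • R) + (1 / 2 : ℝ) • R := by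
    simp only [Pe, hM, hR, smul_smul]
  have hPeP : Pe p q d s * P = P := by
    rw [hPe, add_mul, smul_mul_assoc, sub_mul, smul_mul_assoc, hMP, hRP]
    have : (gap d s)⁻¹ * ((1 - E) - 1 / 2) + 1 / 2 = 1 := by
      rw [show 1 - E - 1 / 2 = gap d s / 2 by linarith]; field_simp; norm_num
    calc _ = ((gap d s)⁻¹ * ((1 - E) - 1 / 2) + 1 / 2) • P := by module
      _ = P := by rw [this, one_smul]
  have hPPe : P * Pe p q d s = Pe p q d s := by
    apply hfull
    rw [Ham_Pe h s hd0 hd1]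
    congr 1; linarith
  have := congrArg star hPeP
  rw [star_mul, hPs, star_Pe h] at this
  rw [← this, hPPe]


lemma gap_zero : gap d 0 = 1 := by simp [gap]
lemma gap_one : gap d 1 = 1 := by simp [gap]
lemma gap_half : gap d (1 / 2) = Real.sqrt d := by
  unfold gap; congr 1; ring

lemma core (h : Rel p q d) (hd0 : 0 < d) (hd1 : d < 1)
    (hC : ‖q * p - p * q‖ ≤ 2 * Real.sqrt d) {τ : ℝ} (hτ : 0 < τ) {U : ℝ → A} (hU0 : U 0 = 1)
    (hU1 : ∀ s ∈ Set.Icc (0:ℝ) 1, star (U s) * U s = 1)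
    (hU : ∀ s ∈ Set.Icc (0:ℝ) 1,
      HasDerivAt U (((-(Complex.I * (τ : ℂ))) • Ham p q s) * U s) s) :
    ‖star (U 1) * Pe p q d 1 * U 1 - Pe p q d 0‖ ≤ 4 / (τ * d) := by
  set c : ℂ := Complex.I / τ with hc
  have hcn : ‖c‖ = 1 / τ := by
    rw [hc, norm_div, Complex.norm_I, Complex.norm_real, Real.norm_of_nonneg hτ.le]
  have hτc : (τ : ℂ) ≠ 0 := by exact_mod_cast hτ.ne'
  set W : A := q * p - p * q with hW
  set Z : ℝ → A := fun s => (gap d s)⁻¹ ^ 3 • W with hZ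
  set X : ℝ → A := fun s => Pe p q d s + c • Z s with hX
  set F : ℝ → A := fun s => star (U s) * X s * U s with hF
  have hcomm : ∀ s, Ham p q s * Pe p q d s = Pe p q d s * Ham p q s := by
    intro s
    have h1 := Ham_Pe h s hd0 hd1
    have h2 := congrArg star h1
    rw [star_mul, star_Ham h, star_Pe h, star_smul, star_Pe h, star_trivial] at h2
    rw [h1, h2]
  have hFd : ∀ s ∈ Set.Icc (0:ℝ) 1, HasDerivAt F
      (star (U s) * (c • ((6 * (1 - d) * (1 - 2 * s) / gap d s ^ 5) • W)) * U s) s := by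
    intro s hs
    have hXd : HasDerivAt X _ s := (Pe_deriv p q s hd0 hd1).add
      (((inv_gap3_deriv s hd0 hd1).smul_const W).const_smul c)
    have hG : star ((-(Complex.I * (τ : ℂ))) • Ham p q s) =
        -((-(Complex.I * (τ : ℂ))) • Ham p q s) := by
      rw [star_smul, star_Ham h]; simp
    refine (conj_deriv (hU s hs) hG hXd).congr_deriv ?_
    congr 2
    rw [← comm_Z h s hd0 hd1]
    have hcc : c * (Complex.I * (τ : ℂ)) = -1 := by
      rw [hc]; field_simp; simp
    have e : X s * ((-(Complex.I * (τ : ℂ))) • Ham p q s) -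
        ((-(Complex.I * (τ : ℂ))) • Ham p q s) * X s =
        (c * (Complex.I * (τ : ℂ))) • (Ham p q s * Z s - Z s * Ham p q s) := by
      simp only [hX, add_mul, mul_add, smul_mul_assoc, mul_smul_comm, hcomm s]
      module
    rw [e, hcc]
    simp only [hZ]
    module
  have hUn : ∀ s ∈ Set.Icc (0:ℝ) 1, ‖U s‖ ≤ 1 := fun s hs => isom_norm_le (hU1 s hs)
  have hconj : ∀ s ∈ Set.Icc (0:ℝ) 1, ∀ Y : A, ‖star (U s) * Y * U s‖ ≤ ‖Y‖ := by
    intro s hs Y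
    have h1 := hUn s hs
    calc _ ≤ ‖star (U s) * Y‖ * ‖U s‖ := norm_mul_le _ _
      _ ≤ (‖star (U s)‖ * ‖Y‖) * ‖U s‖ := by gcongr; exact norm_mul_le _ _
      _ ≤ (1 * ‖Y‖) * 1 := by rw [norm_star]; gcongr
      _ = ‖Y‖ := by ring
  have hFn : ∀ s ∈ Set.Icc (0:ℝ) 1,
      ‖star (U s) * (c • ((6 * (1 - d) * (1 - 2 * s) / gap d s ^ 5) • W)) * U s‖ ≤
      1 / τ * (|6 * (1 - d) * (1 - 2 * s) / gap d s ^ 5| * ‖W‖) := by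
    intro s hs
    refine (hconj s hs _).trans ?_
    rw [norm_smul, norm_smul, hcn, Real.norm_eq_abs]
  have hB : ∀ s, HasDerivAt (fun s => 1 / τ * ((gap d s)⁻¹ ^ 3 * ‖W‖))
      (1 / τ * (6 * (1 - d) * (1 - 2 * s) / gap d s ^ 5 * ‖W‖)) s := fun s =>
    ((inv_gap3_deriv s hd0 hd1).mul_const _).const_mul _
  have key1 : ‖F (1 / 2) - F 0‖ ≤ 1 / τ * ((gap d (1 / 2))⁻¹ ^ 3 * ‖W‖) -
      1 / τ * ((gap d 0)⁻¹ ^ 3 * ‖W‖) := by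
    have := image_norm_le_of_norm_deriv_right_le_deriv_boundary
      (f := fun s => F s - F 0) (a := 0) (b := 1 / 2)
      (B := fun s => 1 / τ * ((gap d s)⁻¹ ^ 3 * ‖W‖) - 1 / τ * ((gap d 0)⁻¹ ^ 3 * ‖W‖))
      (fun s hs => (((hFd s ⟨hs.1, by linarith [hs.2]⟩).sub_const _).continuousAt).continuousWithinAt)
      (fun s hs => ((hFd s ⟨hs.1, by linarith [hs.2]⟩).sub_const _).hasDerivWithinAt)
      (by simp)
      (fun s => (hB s).sub_const _)
      (fun s hs => by
        refine (hFn s ⟨hs.1, by linarith [hs.2]⟩).trans (le_of_eq ?_)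
        rw [abs_of_nonneg]
        have := gap_pos s hd0 hd1
        have h1 : 0 ≤ 1 - d := by linarith
        have h2 : 0 ≤ 1 - 2 * s := by linarith [hs.2]
        positivity)
    exact this (Set.right_mem_Icc.2 (by norm_num))
  have key2 : ‖F 1 - F (1 / 2)‖ ≤ 1 / τ * ((gap d (1 / 2))⁻¹ ^ 3 * ‖W‖) -
      1 / τ * ((gap d 1)⁻¹ ^ 3 * ‖W‖) := by
    have := image_norm_le_of_norm_deriv_right_le_deriv_boundary
      (f := fun s => F s - F (1 / 2)) (a := 1 / 2) (b := 1)
      (B := fun s => 1 / τ * ((gap d (1 / 2))⁻¹ ^ 3 * ‖W‖) - 1 / τ * ((gap d s)⁻¹ ^ 3 * ‖W‖))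
      (fun s hs => (((hFd s ⟨by linarith [hs.1], hs.2⟩).sub_const _).continuousAt).continuousWithinAt)
      (fun s hs => ((hFd s ⟨by linarith [hs.1], hs.2.le⟩).sub_const _).hasDerivWithinAt)
      (by simp)
      (fun s => (hB s).const_sub _)
      (fun s hs => by
        refine (hFn s ⟨by linarith [hs.1], hs.2.le⟩).trans (le_of_eq ?_)
        rw [abs_of_nonpos]
        · ring
        have := gap_pos s hd0 hd1
        have h1 : 0 ≤ 1 - d := by linarith
        have h2 : 1 - 2 * s ≤ 0 := by linarith [hs.1]
        apply div_nonpos_of_nonpos_of_nonneg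
        · exact mul_nonpos_of_nonneg_of_nonpos (by positivity) h2
        · positivity)
    exact this (Set.right_mem_Icc.2 (by norm_num))
  have hZn : ∀ s, gap d s = 1 → ‖c • Z s‖ = 1 / τ * ‖W‖ := by
    intro s hs
    simp only [hZ, hs]
    rw [norm_smul, hcn]; simp
  have e : star (U 1) * Pe p q d 1 * U 1 - Pe p q d 0 =
      (F 1 - F (1 / 2)) + (F (1 / 2) - F 0) - star (U 1) * (c • Z 1) * U 1 + c • Z 0 := by
    simp only [hF, hX, hU0, star_one, mul_one, one_mul, mul_add, add_mul]
    abel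
  rw [e]
  have b1 := hconj 1 (by simp) (c • Z 1)
  rw [hZn 1 gap_one] at b1
  have b0 := hZn 0 gap_zero
  rw [gap_half, gap_one] at key2
  rw [gap_half, gap_zero] at key1
  have hsd : 0 < Real.sqrt d := Real.sqrt_pos.2 hd0
  calc _ ≤ ‖F 1 - F (1 / 2)‖ + ‖F (1 / 2) - F 0‖ + ‖star (U 1) * (c • Z 1) * U 1‖ + ‖c • Z 0‖ := by
        refine (norm_add_le _ _).trans ?_
        gcongr
        refine (norm_sub_le _ _).trans ?_
        gcongr
        exact norm_add_le _ _
    _ ≤ 2 * (1 / τ * ((Real.sqrt d)⁻¹ ^ 3 * ‖W‖)) := by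
        rw [b0]; simp only [inv_one, one_pow, one_mul] at key1 key2; linarith
    _ ≤ 2 * (1 / τ * ((Real.sqrt d)⁻¹ ^ 3 * (2 * Real.sqrt d))) := by gcongr
    _ = 4 / (τ * Real.sqrt d ^ 2) := by field_simp; norm_num
    _ = 4 / (τ * d) := by rw [Real.sq_sqrt hd0.le]

end alg

lemma intertwine {P P' H UA : ℝ → A} {τ : ℝ}
    (hH : ∀ s ∈ Set.Icc (0:ℝ) 1, star (H s) = H s)
    (hPs : ∀ s ∈ Set.Icc (0:ℝ) 1, star (P s) = P s)
    (hPP : ∀ s ∈ Set.Icc (0:ℝ) 1, P s * P s = P s)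
    (hcomm : ∀ s ∈ Set.Icc (0:ℝ) 1, H s * P s = P s * H s)
    (hPd : ∀ s ∈ Set.Icc (0:ℝ) 1, HasDerivAt P (P' s) s)
    (h0 : UA 0 = 1)
    (hUd : ∀ s ∈ Set.Icc (0:ℝ) 1, HasDerivAt UA
      (((-(Complex.I * (τ : ℂ))) • H s + (P' s * P s - P s * P' s)) * UA s) s) :
    star (UA 1) * P 1 * UA 1 = P 0 := by
  have hud : ∀ s ∈ Set.Icc (0:ℝ) 1, UniqueDiffWithinAt ℝ (Set.Icc (0:ℝ) 1) s :=
    fun s hs => uniqueDiffOn_Icc (by norm_num) s hs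
  have hP's : ∀ s ∈ Set.Icc (0:ℝ) 1, star (P' s) = P' s := by
    intro s hs
    exact (hud s hs).eq_deriv _ ((hPd s hs).star.hasDerivWithinAt.congr
      (fun x hx => (hPs x hx).symm) (hPs s hs).symm) (hPd s hs).hasDerivWithinAt
  have hP'e : ∀ s ∈ Set.Icc (0:ℝ) 1, P' s * P s + P s * P' s = P' s := by
    intro s hs
    exact (hud s hs).eq_deriv _ (((hPd s hs).mul (hPd s hs)).hasDerivWithinAt.congr
      (fun x hx => (hPP x hx).symm) (hPP s hs).symm) (hPd s hs).hasDerivWithinAt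
  have hd : ∀ s ∈ Set.Icc (0:ℝ) 1, HasDerivAt (fun t => star (UA t) * P t * UA t) 0 s := by
    intro s hs
    have hG : star ((-(Complex.I * (τ : ℂ))) • H s + (P' s * P s - P s * P' s)) =
        -((-(Complex.I * (τ : ℂ))) • H s + (P' s * P s - P s * P' s)) := by
      simp only [star_add, star_sub, star_mul, star_smul, hH s hs, hPs s hs, hP's s hs]
      simp
      abel
    refine (conj_deriv (hUd s hs) hG (hPd s hs)).congr_deriv ?_
    have e1 := hP'e s hs
    have e2 : P s * P' s * P s = 0 := by
      have := congrArg (fun x => P s * x) e1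
      simp only [mul_add, ← mul_assoc, hPP s hs] at this
      simpa using this
    have e3 : P' s + (P s * ((-(Complex.I * (τ : ℂ))) • H s + (P' s * P s - P s * P' s)) -
      ((-(Complex.I * (τ : ℂ))) • H s + (P' s * P s - P s * P' s)) * P s) = 0 := by
      simp only [mul_add, add_mul, mul_sub, sub_mul, smul_mul_assoc, mul_smul_comm, hcomm s hs]
      simp only [← mul_assoc, hPP s hs, e2]
      simp only [mul_assoc, hPP s hs]
      nth_rewrite 1 [← e1]
      abel
    rw [e3]; simp
  have := constant_of_has_deriv_right_zero (f := fun t => star (UA t) * P t * UA t)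
    (a := 0) (b := 1) (fun s hs => (hd s hs).continuousAt.continuousWithinAt)
    (fun s hs => (hd s ⟨hs.1, hs.2.le⟩).hasDerivWithinAt) 1 (by simp)
  simpa [h0] using this

theorem abstract_main {p q : A} {d : ℝ} (h : Rel p q d) (hp : p ≠ 0) (hq : q ≠ 0)
    (hd0 : 0 < d) (hd1 : d < 1)
    (hC : ‖q * p - p * q‖ ≤ 2 * Real.sqrt d) {τ : ℝ} (hτ : 0 < τ)
    {P P' U UA : ℝ → A} {E : ℝ → ℝ}
    (hPs : ∀ s ∈ Set.Icc (0:ℝ) 1, star (P s) = P s)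
    (hPP : ∀ s ∈ Set.Icc (0:ℝ) 1, P s * P s = P s)
    (hP0 : ∀ s ∈ Set.Icc (0:ℝ) 1, P s ≠ 0)
    (hPd : ∀ s ∈ Set.Icc (0:ℝ) 1, HasDerivAt P (P' s) s)
    (hE : ∀ s ∈ Set.Icc (0:ℝ) 1, Ham p q s * P s = E s • P s)
    (hfull : ∀ s ∈ Set.Icc (0:ℝ) 1, ∀ X : A, Ham p q s * X = E s • X → P s * X = X)
    (hmin : ∀ s ∈ Set.Icc (0:ℝ) 1, ∀ (m : ℝ) (X : A), X ≠ 0 → Ham p q s * X = m • X → E s ≤ m)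
    (hU0 : U 0 = 1) (hUA0 : UA 0 = 1)
    (hU1 : ∀ s ∈ Set.Icc (0:ℝ) 1, star (U s) * U s = 1 ∧ U s * star (U s) = 1)
    (hUA1 : ∀ s ∈ Set.Icc (0:ℝ) 1, star (UA s) * UA s = 1 ∧ UA s * star (UA s) = 1)
    (hU : ∀ s ∈ Set.Icc (0:ℝ) 1,
      HasDerivAt U ((-(Complex.I * (τ : ℂ))) • (Ham p q s * U s)) s)
    (hUA : ∀ s ∈ Set.Icc (0:ℝ) 1, HasDerivAt UA
      (((-(Complex.I * (τ : ℂ))) • Ham p q s + (P' s * P s - P s * P' s)) * UA s) s) :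
    ‖(1 - P 0) * ((star (UA 1) * U 1) * P 0)‖ ≤ 4 / (τ * d) := by
  have m0 : (0:ℝ) ∈ Set.Icc (0:ℝ) 1 := by simp
  have m1 : (1:ℝ) ∈ Set.Icc (0:ℝ) 1 := by simp
  have hPe : ∀ s ∈ Set.Icc (0:ℝ) 1, P s = Pe p q d s := fun s hs =>
    P_eq h hp hq s hd0 hd1 (hPs s hs) (hP0 s hs) (hE s hs) (hfull s hs) (hmin s hs)
  have hcomm : ∀ s ∈ Set.Icc (0:ℝ) 1, Ham p q s * P s = P s * Ham p q s := by
    intro s hs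
    have h2 := congrArg star (hE s hs)
    rw [star_mul, star_Ham h, star_smul, hPs s hs, star_trivial] at h2
    rw [hE s hs, h2]
  have hI := intertwine (H := Ham p q) (fun s _ => star_Ham h s) hPs hPP hcomm hPd hUA0 hUA
  have hc := core h hd0 hd1 hC hτ hU0 (fun s hs => (hU1 s hs).1)
    (fun s hs => by rw [smul_mul_assoc]; exact hU s hs)
  rw [← hPe 0 m0, ← hPe 1 m1] at hc
  obtain ⟨a1, a2⟩ := hUA1 1 m1
  obtain ⟨b1, b2⟩ := hU1 1 m1
  have hUe : (1 - P 0) * ((star (UA 1) * U 1) * P 0) =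
      -(star (UA 1) * U 1 * (star (U 1) * P 1 * U 1 - P 0) * P 0) := by
    have l : (1 - P 0) * ((star (UA 1) * U 1) * P 0) = star (UA 1) * (1 - P 1) * U 1 * P 0 := by
      rw [← hI]
      have : (1 - star (UA 1) * P 1 * UA 1) * star (UA 1) = star (UA 1) * (1 - P 1) := by
        rw [sub_mul, mul_assoc _ (UA 1), a2]; noncomm_ring
      simp only [← mul_assoc]
      rw [this]
    have r : star (UA 1) * U 1 * (star (U 1) * P 1 * U 1 - P 0) * P 0 =
        star (UA 1) * (U 1 * star (U 1)) * P 1 * U 1 * P 0 - star (UA 1) * U 1 * (P 0 * P 0) := by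
      noncomm_ring
    rw [l, r, b2, hPP 0 m0]
    noncomm_ring
  rw [hUe, norm_neg]
  have n1 : ‖star (UA 1)‖ ≤ 1 := by rw [norm_star]; exact isom_norm_le a1
  have n2 : ‖U 1‖ ≤ 1 := isom_norm_le b1
  have n3 : ‖P 0‖ ≤ 1 := proj_norm_le (hPs 0 m0) (hPP 0 m0)
  calc _ ≤ ‖star (UA 1)‖ * ‖U 1‖ * ‖star (U 1) * P 1 * U 1 - P 0‖ * ‖P 0‖ := by
        refine (norm_mul_le _ _).trans ?_
        gcongr
        refine (norm_mul_le _ _).trans ?_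
        gcongr
        exact norm_mul_le _ _
    _ ≤ 1 * 1 * (4 / (τ * d)) * 1 := by gcongr
    _ = _ := by ring

section hilbert
variable {V : Type*} [NormedAddCommGroup V] [InnerProductSpace ℂ V] [CompleteSpace V]

/-- rank one projection -/
noncomputable def rk (a : V) : V →L[ℂ] V := (innerSL ℂ a).smulRight a

lemma rk_apply (a x : V) : rk a x = inner ℂ a x • a := by simp [rk]

lemma rk_ne {a : V} (ha : ‖a‖ = 1) : rk a ≠ 0 := by
  intro h
  have := congrArg (fun f => f a) h
  simp only [rk_apply, inner_self_eq_norm_sq_to_K, ha] at this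
  simp at this
  simp [this] at ha

lemma rk_star (a : V) : star (rk a) = rk a := by
  rw [ContinuousLinearMap.star_eq_adjoint]
  symm
  rw [ContinuousLinearMap.eq_adjoint_iff]
  intro x y
  simp only [rk_apply, inner_smul_left, inner_smul_right, inner_conj_symm]
  ring

lemma rk_rel {a b : V} {δ : ℝ} (ha : ‖a‖ = 1) (hb : ‖b‖ = 1) (hab : inner ℂ a b = (δ : ℂ)) :
    Rel (rk a) (rk b) (δ ^ 2) := by
  have hba : inner ℂ b a = (δ : ℂ) := by rw [← inner_conj_symm, hab, Complex.conj_ofReal]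
  refine ⟨rk_star a, rk_star b, ?_, ?_, ?_, ?_⟩
  · ext1 x
    simp [rk_apply, inner_smul_right, inner_self_eq_norm_sq_to_K, ha]
  · ext1 x
    simp [rk_apply, inner_smul_right, inner_self_eq_norm_sq_to_K, hb]
  · ext1 x
    simp only [mul_apply_eq_comp, smul_apply, rk_apply,
      inner_smul_right, hab, hba]
    rw [← Complex.coe_smul, smul_smul]
    congr 1
    push_cast; ring
  · ext1 x
    simp only [mul_apply_eq_comp, smul_apply, rk_apply,
      inner_smul_right, hab, hba]
    rw [← Complex.coe_smul, smul_smul]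
    congr 1
    push_cast; ring

lemma rk_mul_norm {a b : V} {δ : ℝ} (hδ : 0 ≤ δ) (ha : ‖a‖ = 1) (hb : ‖b‖ = 1)
    (hab : inner ℂ a b = (δ : ℂ)) : ‖rk a * rk b‖ ≤ δ := by
  refine ContinuousLinearMap.opNorm_le_bound _ hδ fun x => ?_
  simp only [mul_apply_eq_comp, rk_apply, inner_smul_right, hab]
  rw [norm_smul, norm_mul, ha, Complex.norm_real, Real.norm_of_nonneg hδ, mul_one, mul_comm]
  have := norm_inner_le_norm (𝕜 := ℂ) b x
  rw [hb, one_mul] at this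
  gcongr

lemma rk_comm_norm {a b : V} {δ : ℝ} (hδ : 0 ≤ δ) (ha : ‖a‖ = 1) (hb : ‖b‖ = 1)
    (hab : inner ℂ a b = (δ : ℂ)) : ‖rk b * rk a - rk a * rk b‖ ≤ 2 * δ := by
  have hba : inner ℂ b a = (δ : ℂ) := by rw [← inner_conj_symm, hab, Complex.conj_ofReal]
  have h1 := rk_mul_norm hδ ha hb hab
  have h2 := rk_mul_norm hδ hb ha hba
  have := norm_sub_le (rk b * rk a) (rk a * rk b)
  linarith

end hilbert

end Grover


/-- **Adiabatic Grover search with linear interpolation (Example, claim 1).**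

There is a constant `C > 0`, independent of `n` and `τ`, such that the following holds
for all `n ≥ 1`.  On `ℂ^{2ⁿ}` let `H₀ = 1 − |0̂⟩⟨0̂|`, `H₁ = 1 − |e_u⟩⟨e_u|` and
`H(s) = (1−s)H₀ + sH₁`.  Let `P s` be the (continuously differentiable family of)
orthogonal spectral projections onto the nondegenerate ground state of `H(s)` (i.e.
`H(s) P(s) = E(s) P(s)` with `E(s)` the smallest eigenvalue, and `P(s)` is the full
eigenprojection), let `U τ` be the unitary Schrödinger propagator of
`i ∂ₛ U = τ H(s) U`, `U τ 0 = 1`, and `UA τ` the unitary adiabatic propagator of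
`i ∂ₛ UA = (τ H(s) + i[Ṗ, P]) UA`, `UA τ 0 = 1`, with wave operator
`Ω_τ(s) = UA_τ(s)* U_τ(s)`.  Then with `g_min = 2^{−n/2}`:
`‖Q(0) Ω_τ(1) P(0)‖ ≤ C / (τ g_min²)` for all `τ > 0`. -/
theorem adiabatic_grover_linear_interpolation :
    ∃ C > (0:ℝ), ∀ n : ℕ, 1 ≤ n → ∀ u : Fin (2 ^ n),
    let V := EuclideanSpace ℂ (Fin (2 ^ n))
    let ψ0 : V := ((Real.sqrt (2 ^ n) : ℂ))⁻¹ • ∑ w, EuclideanSpace.single w (1:ℂ)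
    let H0 : V →L[ℂ] V := 1 - (innerSL ℂ ψ0).smulRight ψ0
    let H1 : V →L[ℂ] V :=
      1 - (innerSL ℂ (EuclideanSpace.single u (1:ℂ))).smulRight (EuclideanSpace.single u (1:ℂ))
    let Hop : ℝ → V →L[ℂ] V := fun s => (1 - s) • H0 + s • H1
    ∀ (P P' : ℝ → V →L[ℂ] V) (E : ℝ → ℝ) (U UA : ℝ → ℝ → V →L[ℂ] V),
      -- `P` is a C¹ family of orthogonal projections:
      (∀ s ∈ Set.Icc (0:ℝ) 1, IsSelfAdjoint (P s)) →
      (∀ s ∈ Set.Icc (0:ℝ) 1, P s ∘L P s = P s) →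
      (∀ s ∈ Set.Icc (0:ℝ) 1, P s ≠ 0) →
      (∀ s ∈ Set.Icc (0:ℝ) 1, HasDerivAt P (P' s) s) →
      ContinuousOn P' (Set.Icc (0:ℝ) 1) →
      -- `P s` is the spectral projection onto the lowest eigenvalue `E s` of `H s`:
      (∀ s ∈ Set.Icc (0:ℝ) 1, Hop s ∘L P s = (E s : ℂ) • P s) →
      (∀ s ∈ Set.Icc (0:ℝ) 1, ∀ v : V, Hop s v = (E s : ℂ) • v → P s v = v) →
      (∀ s ∈ Set.Icc (0:ℝ) 1, ∀ μ : ℝ,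
        Module.End.HasEigenvalue ((Hop s).toLinearMap) ((μ : ℝ) : ℂ) → E s ≤ μ) →
      -- Schrödinger and adiabatic propagators:
      (∀ τ > (0:ℝ), U τ 0 = 1) → (∀ τ > (0:ℝ), UA τ 0 = 1) →
      (∀ τ > (0:ℝ), ∀ s ∈ Set.Icc (0:ℝ) 1,
        ContinuousLinearMap.adjoint (U τ s) ∘L U τ s = 1 ∧
        U τ s ∘L ContinuousLinearMap.adjoint (U τ s) = 1) →
      (∀ τ > (0:ℝ), ∀ s ∈ Set.Icc (0:ℝ) 1,
        ContinuousLinearMap.adjoint (UA τ s) ∘L UA τ s = 1 ∧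
        UA τ s ∘L ContinuousLinearMap.adjoint (UA τ s) = 1) →
      (∀ τ > (0:ℝ), ∀ s ∈ Set.Icc (0:ℝ) 1,
        HasDerivAt (U τ) ((-(Complex.I * (τ : ℂ))) • (Hop s ∘L U τ s)) s) →
      (∀ τ > (0:ℝ), ∀ s ∈ Set.Icc (0:ℝ) 1,
        HasDerivAt (UA τ)
          (((-(Complex.I * (τ : ℂ))) • Hop s + (P' s ∘L P s - P s ∘L P' s)) ∘L UA τ s) s) →
      ∀ τ > (0:ℝ),
        ‖((1 : V →L[ℂ] V) - P 0) ∘L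
            (ContinuousLinearMap.adjoint (UA τ 1) ∘L U τ 1) ∘L P 0‖
          ≤ C / (τ * ((2:ℝ) ^ (-(n:ℝ) / 2)) ^ 2) := by
  refine ⟨4, by norm_num, ?_⟩
  intro n hn u V ψ0 H0 H1 Hop P P' E U UA hPs hPP hP0 hPd _ hE hfull hmin hU0 hUA0 hU1 hUA1 hU hUA
    τ hτ
  have h2n : (0:ℝ) < 2 ^ n := by positivity
  have hsq : Real.sqrt (2 ^ n) ^ 2 = 2 ^ n := Real.sq_sqrt h2n.le
  have hsp : 0 < Real.sqrt (2 ^ n) := Real.sqrt_pos.2 h2n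
  set e : V := EuclideanSpace.single u (1:ℂ) with he
  have hψ : ∀ w, ψ0 w = ((Real.sqrt (2 ^ n) : ℂ))⁻¹ := by
    intro w
    simp [ψ0, Finset.sum_apply, PiLp.single_apply]
  have hψn : ‖ψ0‖ = 1 := by
    rw [EuclideanSpace.norm_eq, Real.sqrt_eq_one]
    simp only [hψ]
    rw [Finset.sum_const, Finset.card_univ, Fintype.card_fin, norm_inv, Complex.norm_real,
      Real.norm_of_nonneg hsp.le, inv_pow, hsq]
    simp
  have hen : ‖e‖ = 1 := (EuclideanSpace.norm_single u (1:ℂ)).trans norm_one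
  set δ : ℝ := (Real.sqrt (2 ^ n))⁻¹ with hδ
  have hδ0 : 0 < δ := by positivity
  have hin : inner ℂ ψ0 e = (δ : ℂ) := by
    rw [he, EuclideanSpace.inner_single_right, hψ]
    simp [hδ]
  have hd : δ ^ 2 = (2 ^ n)⁻¹ := by rw [hδ, inv_pow, hsq]
  have hd0 : 0 < δ ^ 2 := by positivity
  have hd1 : δ ^ 2 < 1 := by
    rw [hd]
    apply inv_lt_one_of_one_lt₀
    exact one_lt_pow₀ (by norm_num) (by omega)
  have hg : ((2:ℝ) ^ (-(n:ℝ) / 2)) ^ 2 = δ ^ 2 := by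
    rw [hd, ← Real.rpow_natCast, ← Real.rpow_mul (by norm_num)]
    rw [show -(n:ℝ) / 2 * ((2:ℕ) : ℝ) = -(n:ℝ) by push_cast; ring]
    rw [Real.rpow_neg (by norm_num), Real.rpow_natCast]
  rw [hg]
  have hH : ∀ s, Hop s = Grover.Ham (Grover.rk ψ0) (Grover.rk e) s := fun s => rfl
  have hC := Grover.rk_comm_norm hδ0.le hψn hen hin
  refine Grover.abstract_main (E := E) (P' := P') (Grover.rk_rel hψn hen hin) (Grover.rk_ne hψn)
    (Grover.rk_ne hen) hd0 hd1 ?_ hτ hPs hPP hP0 hPd ?_ ?_ ?_ (hU0 τ hτ) (hUA0 τ hτ)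
    (hU1 τ hτ) (hUA1 τ hτ) (hU τ hτ) (hUA τ hτ)
  · rw [Real.sqrt_sq hδ0.le]; exact hC
  · intro s hs
    rw [← hH]
    exact hE s hs
  · intro s hs X hX
    rw [← hH] at hX
    ext1 x
    apply hfull s hs
    have := congrArg (fun f => f x) hX
    simp only [mul_apply_eq_comp, smul_apply] at this
    exact this.trans (Complex.coe_smul _ _).symm
  · intro s hs m X hX0 hX
    rw [← hH] at hX
    obtain ⟨x, hx⟩ : ∃ x, X x ≠ 0 := by
      by_contra hc
      push Not at hc
      exact hX0 (ContinuousLinearMap.ext hc)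
    apply hmin s hs
    refine Module.End.hasEigenvalue_of_hasEigenvector (x := X x) ⟨?_, hx⟩
    rw [Module.End.mem_eigenspace_iff]
    have := congrArg (fun f => f x) hX
    simp only [mul_apply_eq_comp, smul_apply] at this
    rw [Complex.coe_smul]
    exact this
end

section
/- Adiabatic Grover search with adapted schedule (Example, claim 2): There exist a constant C > 0 such that for every n ≥ 1 there is a surjective, strictly increasing, continuously differentiable function f : [0,1] → [0,1] with f(0) = 0 and f(1) = 1 such that, for H(s) := (1 − f(s))H₀ + f(s)H₁ on ℂ^{2ⁿ}, with P(s) the orthogonal projection onto the nondegenerate ground state of H(s), Q(s) := 1 − P(s), and g_min := 2^{−n/2}, one has ‖Q(0) Ω_τ(1) P(0)‖ ≤ C / (τ g_min) for all τ > 0. -/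
section
open Set

lemma ag_ode (α d : ℝ → ℂ) (e0 e1 h h' : ℝ → ℝ) (c τ g : ℝ) (hc0 : 0 ≤ c) (hc : c ≤ 2)
    (hτ : 0 < τ) (hg : 0 < g)
    (hα : ∀ s ∈ Icc (0:ℝ) 1, HasDerivAt α (c * d s - Complex.I * τ * e0 s * α s) s)
    (hd : ∀ s ∈ Icc (0:ℝ) 1, HasDerivAt d (-c * α s - Complex.I * τ * e1 s * d s) s)
    (hh : ∀ s ∈ Icc (0:ℝ) 1, HasDerivAt h (h' s) s)
    (hhe : ∀ s ∈ Icc (0:ℝ) 1, h s * (e1 s - e0 s) = 1)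
    (hb : ∀ s ∈ Icc (0:ℝ) 1, |h s| ≤ 1 / g)
    (hb' : ∀ s ∈ Icc (0:ℝ) 1, |h' s| ≤ 4 / g)
    (he1 : ContinuousOn e1 (Icc 0 1))
    (hα0 : α 0 = 1) (hd0 : d 0 = 0) :
    ‖α 1‖ ^ 2 + ‖d 1‖ ^ 2 = 1 ∧ ‖d 1‖ ≤ 16 / (τ * g) := by
  have hcons : ∀ s ∈ Icc (0:ℝ) 1, ‖α s‖ ^ 2 + ‖d s‖ ^ 2 = 1 := by
    have key : ∀ s ∈ Icc (0:ℝ) 1, HasDerivAt (fun s => ‖α s‖ ^ 2 + ‖d s‖ ^ 2) 0 s := by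
      intro s hs
      have := ((hα s hs).norm_sq).add ((hd s hs).norm_sq)
      refine this.congr_deriv ?_
      simp [Complex.inner]
      ring
    intro s hs
    have := constant_of_has_deriv_right_zero (f := fun s => ‖α s‖ ^ 2 + ‖d s‖ ^ 2) (a := 0) (b := 1)
      (fun s hs => (key s hs).continuousAt.continuousWithinAt)
      (fun s hs => (key s ⟨hs.1, hs.2.le⟩).hasDerivWithinAt) s hs
    simpa [hα0, hd0] using this
  refine ⟨hcons 1 (by simp), ?_⟩
  have hα1 : ∀ s ∈ Icc (0:ℝ) 1, ‖α s‖ ≤ 1 := fun s hs => by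
    nlinarith [hcons s hs, norm_nonneg (α s), sq_nonneg ‖d s‖]
  have hd1 : ∀ s ∈ Icc (0:ℝ) 1, ‖d s‖ ≤ 1 := fun s hs => by
    nlinarith [hcons s hs, norm_nonneg (d s), sq_nonneg ‖α s‖]
  -- phase
  have hEc : Continuous (IccExtend (zero_le_one' ℝ) ((Icc (0:ℝ) 1).domRestrict e1)) :=
    (continuousOn_iff_continuous_domRestrict.1 he1).Icc_extend'
  obtain ⟨θ, hθ⟩ : ∃ θ : ℝ → ℝ, ∀ s ∈ Icc (0:ℝ) 1, HasDerivAt θ (e1 s) s := by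
    refine ⟨fun s => ∫ t in (0:ℝ)..s, IccExtend (zero_le_one' ℝ) ((Icc (0:ℝ) 1).domRestrict e1) t, ?_⟩
    intro s hs
    have := intervalIntegral.integral_hasDerivAt_right (hEc.intervalIntegrable 0 s)
      (hEc.stronglyMeasurableAtFilter _ _) hEc.continuousAt
    rwa [IccExtend_of_mem _ _ hs] at this
  set γ : ℝ → ℂ := fun s => d s + c * (h s * α s) / (Complex.I * τ) with hγ
  set r : ℝ → ℂ := fun s => c / (Complex.I * τ) * (h' s * α s + h s * c * d s) with hr
  have hτ' : (τ : ℂ) ≠ 0 := by exact_mod_cast hτ.ne'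
  have hγd : ∀ s ∈ Icc (0:ℝ) 1, HasDerivAt γ (-Complex.I * τ * e1 s * γ s + r s) s := by
    intro s hs
    have h1 := (hd s hs).add (((((hh s hs).ofReal_comp).mul (hα s hs)).const_mul (c:ℂ)).div_const
      (Complex.I * τ))
    refine h1.congr_deriv ?_
    have h2 : (h s : ℂ) * (e1 s - e0 s) = 1 := by exact_mod_cast hhe s hs
    have hI := Complex.I_ne_zero
    simp only [hγ, hr]
    field_simp
    linear_combination (c * α s * τ * Complex.I) * h2
  set G : ℝ → ℂ := fun s => Complex.exp (Complex.I * τ * θ s) * γ s with hG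
  have hGd : ∀ s ∈ Icc (0:ℝ) 1, HasDerivAt G (Complex.exp (Complex.I * τ * θ s) * r s) s := by
    intro s hs
    have h1 := ((((hθ s hs).ofReal_comp).const_mul (Complex.I * τ)).cexp).mul (hγd s hs)
    refine h1.congr_deriv ?_
    ring
  have hexp : ∀ s, ‖Complex.exp (Complex.I * τ * θ s)‖ = 1 := by
    intro s
    have : Complex.I * τ * θ s = ((τ * θ s : ℝ) : ℂ) * Complex.I := by push_cast; ring
    rw [this, Complex.norm_exp_ofReal_mul_I]
  have hrb : ∀ s ∈ Icc (0:ℝ) 1, ‖r s‖ ≤ 12 / (τ * g) := by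
    intro s hs
    have h1 : ‖(h' s * α s + h s * c * d s : ℂ)‖ ≤ 6 / g := by
      calc _ ≤ |h' s| * ‖α s‖ + |h s| * c * ‖d s‖ := by
            refine (norm_add_le _ _).trans (le_of_eq ?_)
            simp [abs_of_nonneg hc0]
        _ ≤ 4 / g * 1 + 1 / g * 2 * 1 := by
            gcongr
            · exact hb' s hs
            · exact hα1 s hs
            · exact hb s hs
            · exact hd1 s hs
        _ = 6 / g := by ring
    calc ‖r s‖ = c / τ * ‖(h' s * α s + h s * c * d s : ℂ)‖ := by
            simp [hr, abs_of_nonneg hc0, abs_of_pos hτ]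
      _ ≤ 2 / τ * (6 / g) := by gcongr
      _ = _ := by field_simp; norm_num
  have hcorr : ∀ s ∈ Icc (0:ℝ) 1, ‖(c * (h s * α s) / (Complex.I * τ) : ℂ)‖ ≤ 2 / (τ * g) := by
    intro s hs
    calc _ = c / τ * (|h s| * ‖α s‖) := by
            simp [abs_of_nonneg hc0, abs_of_pos hτ]; ring
      _ ≤ 2 / τ * (1 / g * 1) := by
            gcongr
            · exact hb s hs
            · exact hα1 s hs
      _ = _ := by field_simp
  have hmv := norm_image_sub_le_of_norm_deriv_le_segment_01' (f := G)
    (fun s hs => (hGd s hs).hasDerivWithinAt) (C := 12 / (τ * g))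
    (fun s hs => by rw [norm_mul, hexp, one_mul]; exact hrb s ⟨hs.1, hs.2.le⟩)
  have hG1 : ‖G 1‖ = ‖γ 1‖ := by simp only [hG]; rw [norm_mul, hexp, one_mul]
  have hG0 : ‖G 0‖ ≤ 2 / (τ * g) := by
    simp only [hG]; rw [norm_mul, hexp, one_mul]
    simp only [hγ, hd0, zero_add]
    exact hcorr 0 (by simp)
  have h3 : ‖d 1‖ ≤ ‖γ 1‖ + 2 / (τ * g) := by
    have : d 1 = γ 1 - c * (h 1 * α 1) / (Complex.I * τ) := by simp [hγ]
    rw [this]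
    exact (norm_sub_le _ _).trans (by gcongr; exact hcorr 1 (by simp))
  have h4 : ‖G 1‖ ≤ ‖G 0‖ + 12 / (τ * g) := by
    have := norm_le_norm_add_norm_sub' (G 1) (G 0)
    linarith
  have : (16:ℝ) / (τ * g) = 2 / (τ * g) + 2 / (τ * g) + 12 / (τ * g) := by ring
  linarith

variable {V : Type*} [NormedAddCommGroup V] [InnerProductSpace ℂ V] [CompleteSpace V]

lemma ag_intertwine (H P P' UA : ℝ → V →L[ℂ] V) (E : ℝ → ℝ) (τ : ℝ)
    (hH : ∀ s, IsSelfAdjoint (H s))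
    (hPs : ∀ s ∈ Icc (0:ℝ) 1, IsSelfAdjoint (P s))
    (hPP : ∀ s ∈ Icc (0:ℝ) 1, P s * P s = P s)
    (hPd : ∀ s ∈ Icc (0:ℝ) 1, HasDerivAt P (P' s) s)
    (hHP : ∀ s ∈ Icc (0:ℝ) 1, H s * P s = (E s : ℂ) • P s)
    (h0 : UA 0 = 1)
    (hd : ∀ s ∈ Icc (0:ℝ) 1, HasDerivAt UA
      (((-(Complex.I * (τ : ℂ))) • H s + (P' s * P s - P s * P' s)) * UA s) s) :
    star (UA 1) * P 1 * UA 1 = P 0 := by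
  have key : ∀ s ∈ Icc (0:ℝ) 1, HasDerivAt (fun s => star (UA s) * P s * UA s) 0 s := by
    intro s hs
    have hPP' : P' s * P s + P s * P' s = P' s := by
      have h1 := ((hPd s hs).mul (hPd s hs)).hasDerivWithinAt (s := Icc (0:ℝ) 1)
      have h2 := ((hPd s hs).hasDerivWithinAt (s := Icc (0:ℝ) 1)).congr
        (f₁ := P * P) (fun x hx => hPP x hx) (hPP s hs)
      exact UniqueDiffWithinAt.eq_deriv _ (uniqueDiffOn_Icc zero_lt_one s hs) h1 h2
    have hP's : star (P' s) = P' s := by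
      have h1 := ((hPd s hs).star).hasDerivWithinAt (s := Icc (0:ℝ) 1)
      have h2 := ((hPd s hs).hasDerivWithinAt (s := Icc (0:ℝ) 1)).congr
        (f₁ := fun x => star (P x)) (fun x hx => hPs x hx) (hPs s hs)
      exact UniqueDiffWithinAt.eq_deriv _ (uniqueDiffOn_Icc zero_lt_one s hs) h1 h2
    have hPH : P s * H s = (E s : ℂ) • P s := by
      have := congrArg star (hHP s hs)
      simpa [star_mul, star_smul, (hH s).star_eq, (hPs s hs).star_eq] using this
    have hPPP : P s * P' s * P s = 0 := by
      have h1 : P s * (P' s * P s + P s * P' s) * P s = P s * P' s * P s := by rw [hPP']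
      have h2 : P s * (P' s * P s + P s * P' s) * P s
          = P s * P' s * (P s * P s) + (P s * P s) * P' s * P s := by noncomm_ring
      rw [h2, hPP s hs] at h1
      simpa using h1
    have h1 := (((hd s hs).star).mul (hPd s hs)).mul (hd s hs)
    refine h1.congr_deriv ?_
    simp only [Pi.mul_apply, star_mul, star_add, star_sub, star_smul, hP's, (hH s).star_eq, (hPs s hs).star_eq]
    have hst : star (-(Complex.I * (τ:ℂ))) = Complex.I * τ := by simp
    rw [hst]
    have hmid : (((Complex.I * (τ:ℂ)) • H s + (P s * P' s - P' s * P s)) * P s + P' s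
        + P s * ((-(Complex.I * (τ : ℂ))) • H s + (P' s * P s - P s * P' s))) = 0 := by
      have e1 : P s * (P s * P' s) = P s * P' s := by rw [← mul_assoc, hPP s hs]
      have e2 : P' s * P s * P s = P' s * P s := by rw [mul_assoc, hPP s hs]
      have e3 : P s * (P' s * P s) = 0 := by rw [← mul_assoc, hPPP]
      simp only [add_mul, mul_add, sub_mul, mul_sub, smul_mul_assoc, mul_smul_comm, hHP s hs, hPH,
        e1, e2, e3, hPPP]
      nth_rewrite 2 [← hPP']
      module
    calc _ = star (UA s) * (((Complex.I * (τ:ℂ)) • H s + (P s * P' s - P' s * P s)) * P s + P' s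
        + P s * ((-(Complex.I * (τ : ℂ))) • H s + (P' s * P s - P s * P' s))) * UA s := by
          noncomm_ring
      _ = 0 := by rw [hmid]; simp
  have := constant_of_has_deriv_right_zero (f := fun s => star (UA s) * P s * UA s) (a := 0) (b := 1)
      (fun s hs => (key s hs).continuousAt.continuousWithinAt)
      (fun s hs => (key s ⟨hs.1, hs.2.le⟩).hasDerivWithinAt) 1 (by simp)
  simpa [h0] using this

/-- Identification of the ground-state projection. -/
lemma ag_proj (H P : V →L[ℂ] V) (E : ℝ) (v w : V) (e0 e1 : ℝ)
    (hvv : inner ℂ v v = 1) 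
    (hH : IsSelfAdjoint H) (hHv : H v = (e0 : ℂ) • v) (hHw : H w = (e1 : ℂ) • w)
    (hHz : ∀ z, inner ℂ v z = 0 → inner ℂ w z = 0 → H z = z)
    (hwv : inner ℂ w v = 0)
    (h01 : e0 < e1) (h0 : e0 < 1)
    (hPs : IsSelfAdjoint P) (hP0 : P ≠ 0)
    (hHP : H ∘L P = (E : ℂ) • P)
    (hPfix : ∀ x : V, H x = (E : ℂ) • x → P x = x)
    (hmin : ∀ μ : ℝ, Module.End.HasEigenvalue (H.toLinearMap) ((μ : ℝ) : ℂ) → E ≤ μ) :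
    ∀ x, P x = inner ℂ v x • v := by
  have hsym : ∀ x y, inner ℂ (H x) y = inner ℂ x (H y) := fun x y => by
    rw [← ContinuousLinearMap.adjoint_inner_left, hH.adjoint_eq]
  have hPsym : ∀ x y, inner ℂ (P x) y = inner ℂ x (P y) := fun x y => by
    rw [← ContinuousLinearMap.adjoint_inner_left, hPs.adjoint_eq]
  have hv0 : v ≠ 0 := by rintro rfl; simp at hvv
  have hEle : E ≤ e0 := hmin e0 (Module.End.hasEigenvalue_of_hasEigenvector
    (Module.End.hasEigenvector_iff.2 ⟨Module.End.mem_eigenspace_iff.2 hHv, hv0⟩))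
  have hPx : ∀ x, H (P x) = (E : ℂ) • P x := fun x => by
    have := congrArg (fun T : V →L[ℂ] V => T x) hHP
    simpa using this
  have hw : ∀ y, H y = (E : ℂ) • y → inner ℂ w y = 0 := by
    intro y hy
    have h1 := hsym w y
    rw [hHw, hy, inner_smul_left, inner_smul_right, Complex.conj_ofReal] at h1
    have h2 : ((e1 : ℂ) - E) * inner ℂ w y = 0 := by linear_combination h1
    rcases mul_eq_zero.1 h2 with h | h
    · have : e1 - E = 0 := by exact_mod_cast h
      linarith
    · exact h
  have hzero : ∀ y, H y = (E : ℂ) • y → inner ℂ v y = 0 → y = 0 := by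
    intro y hy hvy
    have h1 := hHz y hvy (hw y hy)
    rw [hy] at h1
    have h2 : ((E : ℂ) - 1) • y = 0 := by rw [sub_smul, h1]; simp
    rcases smul_eq_zero.1 h2 with h | h
    · have : E - 1 = 0 := by exact_mod_cast h
      linarith
    · exact h
  have hEe : E = e0 := by
    obtain ⟨x, hx⟩ : ∃ x, P x ≠ 0 := by
      by_contra! hcon
      exact hP0 (ContinuousLinearMap.ext hcon)
    have h1 := hsym v (P x)
    rw [hHv, hPx, inner_smul_left, inner_smul_right, Complex.conj_ofReal] at h1
    have h2 : ((e0 : ℂ) - E) * inner ℂ v (P x) = 0 := by linear_combination h1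
    rcases mul_eq_zero.1 h2 with h | h
    · have : e0 - E = 0 := by exact_mod_cast h
      linarith
    · exact absurd (hzero _ (hPx x) h) hx
  subst hEe
  intro x
  have h1 : P x - inner ℂ v (P x) • v = 0 := by
    apply hzero
    · rw [map_sub, map_smul, hPx, hHv]; module
    · rw [inner_sub_right, inner_smul_right, hvv]; ring
  rw [← hPsym, hPfix v hHv] at h1
  exact sub_eq_zero.1 h1

lemma ag_frame (a b : V) (φ x y : ℝ) (hxy : x + y = φ) (hs : Real.sin φ ≠ 0)
    (haa : inner ℂ a a = 1) (hbb : inner ℂ b b = 1) (hab : inner ℂ a b = (Real.cos φ : ℂ)) 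
    (v w : V) (hv : v = (Real.sin x / Real.sin φ) • a + (Real.sin y / Real.sin φ) • b)
    (hw : w = (- Real.cos x / Real.sin φ) • a + (Real.cos y / Real.sin φ) • b) :
    inner ℂ v v = 1 ∧ inner ℂ w w = 1 ∧ inner ℂ v w = 0 ∧ inner ℂ w v = 0 ∧
    a = Real.cos y • v - Real.sin y • w ∧ b = Real.cos x • v + Real.sin x • w := by
  have hba : inner ℂ b a = (Real.cos φ : ℂ) := by
    rw [← inner_conj_symm, hab, Complex.conj_ofReal]
  have hsφ : Real.sin φ = Real.sin x * Real.cos y + Real.cos x * Real.sin y := by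
    rw [← hxy, Real.sin_add]
  have hcφ : Real.cos φ = Real.cos x * Real.cos y - Real.sin x * Real.sin y := by
    rw [← hxy, Real.cos_add]
  have hx := Real.sin_sq_add_cos_sq x
  have hy := Real.sin_sq_add_cos_sq y
  have gen : ∀ p q p' q' : ℝ, inner ℂ (p • a + q • b) (p' • a + q' • b)
      = ((p * p' + q * q' + (p * q' + q * p') * Real.cos φ : ℝ) : ℂ) := by
    intro p q p' q'
    simp only [inner_add_left, inner_add_right, inner_smul_left_eq_smul, inner_smul_right_eq_smul,
      haa, hbb, hab, hba, Complex.real_smul]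
    push_cast; ring
  refine ⟨?_, ?_, ?_, ?_, ?_, ?_⟩
  · rw [hv, gen]; norm_cast; field_simp
    rw [hsφ, hcφ]; grind
  · rw [hw, gen]; norm_cast; field_simp
    rw [hsφ, hcφ]; grind
  · rw [hv, hw, gen]; norm_cast; field_simp
    rw [hcφ]; grind
  · rw [hv, hw, gen]; norm_cast; field_simp
    rw [hcφ]; grind
  · rw [hv, hw]
    match_scalars
    · field_simp; grind
    · field_simp; grind
  · rw [hv, hw]
    match_scalars
    · field_simp; grind
    · field_simp; grind

lemma ag_H (a b v w : V) (x y f : ℝ) (H : V →L[ℂ] V)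
    (hH : H = (1 - f) • (1 - (innerSL ℂ a).smulRight a) + f • (1 - (innerSL ℂ b).smulRight b))
    (hvv : inner ℂ v v = 1) (hww : inner ℂ w w = 1) (hvw : inner ℂ v w = 0)
    (hwv : inner ℂ w v = 0)
    (ha : a = Real.cos y • v - Real.sin y • w) (hb : b = Real.cos x • v + Real.sin x • w)
    (hf : (1 - f) * (Real.sin y * Real.cos y) = f * (Real.sin x * Real.cos x)) :
    H v = ((1 - ((1 - f) * Real.cos y ^ 2 + f * Real.cos x ^ 2) : ℝ) : ℂ) • v ∧
    H w = ((1 - ((1 - f) * Real.sin y ^ 2 + f * Real.sin x ^ 2) : ℝ) : ℂ) • w ∧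
    (∀ z, inner ℂ v z = 0 → inner ℂ w z = 0 → H z = z) := by
  have hz : ∀ z, H z = (1 - f) • (z - (inner ℂ a z) • a) + f • (z - (inner ℂ b z) • b) := by
    intro z; simp [hH]
  have iaz : ∀ z, inner ℂ a z = Real.cos y * inner ℂ v z - Real.sin y * inner ℂ w z := by
    intro z
    rw [ha]
    simp only [inner_sub_left, inner_smul_left_eq_smul, Complex.real_smul]
  have ibz : ∀ z, inner ℂ b z = Real.cos x * inner ℂ v z + Real.sin x * inner ℂ w z := by
    intro z
    rw [hb]
    simp only [inner_add_left, inner_smul_left_eq_smul, Complex.real_smul]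
  have conv : ∀ (r : ℝ) (z : V), r • z = (r : ℂ) • z := fun r z => (Complex.coe_smul r z).symm
  have hfC : (1 - (f:ℂ)) * (Real.sin y * Real.cos y) = f * (Real.sin x * Real.cos x) := by
    exact_mod_cast hf
  push_cast at hfC
  refine ⟨?_, ?_, ?_⟩
  · rw [hz, iaz, ibz, hvv, hwv]
    simp only [ha, hb, conv]
    match_scalars
    · push_cast; ring
    · push_cast; linear_combination hfC
  · rw [hz, iaz, ibz, hww, hvw]
    simp only [ha, hb, conv]
    match_scalars
    · push_cast; ring
    · push_cast; linear_combination hfC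
  · intro z h1 h2
    rw [hz, iaz, ibz, h1, h2]
    simp only [conv]
    match_scalars <;> push_cast <;> ring

lemma ag_Hsa (a b : V) (f : ℝ) :
    IsSelfAdjoint ((1 - f) • (1 - (innerSL ℂ a).smulRight a) +
      f • (1 - (innerSL ℂ b).smulRight b) : V →L[ℂ] V) := by
  have key : ∀ c : V, IsSelfAdjoint (1 - (innerSL ℂ c).smulRight c : V →L[ℂ] V) := by
    intro c
    rw [ContinuousLinearMap.isSelfAdjoint_iff_isSymmetric]
    intro x y
    simp [inner_sub_left, inner_sub_right, inner_smul_left, inner_smul_right, mul_comm]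
  exact ((IsSelfAdjoint.all _).smul (key a)).add ((IsSelfAdjoint.all _).smul (key b))


lemma ag_trig (φ s : ℝ) (hφ : 0 < φ) (hφ2 : φ < Real.pi / 2) (hs : s ∈ Icc (0:ℝ) 1) :
    0 < Real.cos ((2 * s - 1) * φ) ∧ 0 < Real.cos ((1 - s) * φ) ∧ 0 < Real.cos (s * φ) := by
  obtain ⟨h0, h1⟩ := hs
  refine ⟨Real.cos_pos_of_mem_Ioo ⟨?_, ?_⟩, Real.cos_pos_of_mem_Ioo ⟨?_, ?_⟩,
    Real.cos_pos_of_mem_Ioo ⟨?_, ?_⟩⟩ <;> nlinarith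

/-- The adapted schedule. -/
noncomputable def agF (φ s : ℝ) : ℝ := 1 / 2 + Real.tan ((2 * s - 1) * φ) / (2 * Real.tan φ)

noncomputable def agF' (φ s : ℝ) : ℝ :=
  (1 / Real.cos ((2 * s - 1) * φ) ^ 2 * (2 * φ)) / (2 * Real.tan φ)

lemma agF_deriv (φ s : ℝ) (hφ : 0 < φ) (hφ2 : φ < Real.pi / 2) (hs : s ∈ Icc (0:ℝ) 1) :
    HasDerivAt (agF φ) (agF' φ s) s := by
  have h1 : HasDerivAt (fun s : ℝ => (2 * s - 1) * φ) (2 * φ) s := by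
    simpa using (((hasDerivAt_id s).const_mul 2).sub_const 1).mul_const φ
  have h2 := (Real.hasDerivAt_tan (ag_trig φ s hφ hφ2 hs).1.ne').comp s h1
  exact (h2.div_const (2 * Real.tan φ)).const_add (1 / 2)

lemma agF_eq (φ s : ℝ) (hφ : 0 < φ) (hφ2 : φ < Real.pi / 2) (hs : s ∈ Icc (0:ℝ) 1) :
    agF φ s = (Real.sin (s * φ) * Real.cos (s * φ)) /
        (Real.sin φ * Real.cos ((2 * s - 1) * φ)) ∧
    1 - agF φ s = (Real.sin ((1 - s) * φ) * Real.cos ((1 - s) * φ)) /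
        (Real.sin φ * Real.cos ((2 * s - 1) * φ)) := by
  have hc := (ag_trig φ s hφ hφ2 hs).1
  have hsin : 0 < Real.sin φ := Real.sin_pos_of_pos_of_lt_pi hφ (by linarith [Real.pi_pos])
  have hcos : 0 < Real.cos φ := Real.cos_pos_of_mem_Ioo ⟨by linarith, hφ2⟩
  have e1 : Real.sin φ * Real.cos ((2 * s - 1) * φ) + Real.cos φ * Real.sin ((2 * s - 1) * φ)
      = 2 * Real.sin (s * φ) * Real.cos (s * φ) := by
    rw [← Real.sin_add, ← Real.sin_two_mul]; ring_nf
  have e2 : Real.sin φ * Real.cos ((2 * s - 1) * φ) - Real.cos φ * Real.sin ((2 * s - 1) * φ)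
      = 2 * Real.sin ((1 - s) * φ) * Real.cos ((1 - s) * φ) := by
    rw [← Real.sin_sub, ← Real.sin_two_mul]; ring_nf
  have h1 : agF φ s = (Real.sin (s * φ) * Real.cos (s * φ)) /
        (Real.sin φ * Real.cos ((2 * s - 1) * φ)) := by
    unfold agF
    rw [Real.tan_eq_sin_div_cos, Real.tan_eq_sin_div_cos]
    generalize Real.sin (s * φ) = S at *
    generalize Real.cos (s * φ) = T at *
    generalize Real.cos ((2 * s - 1) * φ) = p at *
    generalize Real.sin ((2 * s - 1) * φ) = q at *
    field_simp
    linarith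
  refine ⟨h1, ?_⟩
  rw [h1]
  generalize Real.sin (s * φ) = S at *
  generalize Real.cos (s * φ) = T at *
  generalize Real.cos ((2 * s - 1) * φ) = p at *
  generalize Real.sin ((2 * s - 1) * φ) = q at *
  generalize Real.sin ((1 - s) * φ) = S' at *
  generalize Real.cos ((1 - s) * φ) = T' at *
  field_simp
  linarith

/-- All schedule properties. -/
lemma agF_props (φ : ℝ) (hφ : 0 < φ) (hφ2 : φ < Real.pi / 2) :
    StrictMonoOn (agF φ) (Icc (0:ℝ) 1) ∧ agF φ 0 = 0 ∧ agF φ 1 = 1 ∧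
    MapsTo (agF φ) (Icc (0:ℝ) 1) (Icc (0:ℝ) 1) ∧ SurjOn (agF φ) (Icc (0:ℝ) 1) (Icc (0:ℝ) 1) ∧
    (∀ s ∈ Icc (0:ℝ) 1, HasDerivAt (agF φ) (agF' φ s) s) ∧
    ContinuousOn (agF' φ) (Icc (0:ℝ) 1) := by
  have htan : 0 < Real.tan φ := Real.tan_pos_of_pos_of_lt_pi_div_two hφ hφ2
  have hd := fun s hs => agF_deriv φ s hφ hφ2 hs
  have hcont : ContinuousOn (agF φ) (Icc (0:ℝ) 1) :=
    fun s hs => (hd s hs).continuousAt.continuousWithinAt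
  have hmono : StrictMonoOn (agF φ) (Icc (0:ℝ) 1) := by
    apply strictMonoOn_of_deriv_pos (convex_Icc 0 1) hcont
    intro s hs
    rw [interior_Icc] at hs
    have hs' : s ∈ Icc (0:ℝ) 1 := ⟨hs.1.le, hs.2.le⟩
    rw [(hd s hs').deriv]
    have := (ag_trig φ s hφ hφ2 hs').1
    unfold agF'
    positivity
  have h0 : agF φ 0 = 0 := by
    unfold agF
    have : (2 * (0:ℝ) - 1) * φ = -φ := by ring
    rw [this, Real.tan_neg]
    field_simp; norm_num
  have h1 : agF φ 1 = 1 := by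
    unfold agF
    have : (2 * (1:ℝ) - 1) * φ = φ := by ring
    rw [this]
    field_simp; norm_num
  refine ⟨hmono, h0, h1, ?_, ?_, hd, ?_⟩
  · intro s hs
    constructor
    · rw [← h0]; exact hmono.monotoneOn (by simp) hs hs.1
    · rw [← h1]; exact hmono.monotoneOn hs (by simp) hs.2
  · have := intermediate_value_Icc (zero_le_one' ℝ) hcont
    rwa [h0, h1] at this
  · unfold agF'
    refine ContinuousOn.div_const (ContinuousOn.mul (ContinuousOn.div continuousOn_const ?_ ?_)
      continuousOn_const) _
    · fun_prop
    · intro s hs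
      exact pow_ne_zero 2 (ag_trig φ s hφ hφ2 hs).1.ne'

lemma ag_core (a b : V) (φ : ℝ) (hφ : 0 < φ) (hφ2 : φ < Real.pi / 2)
    (haa : inner ℂ a a = 1) (hbb : inner ℂ b b = 1) (hab : inner ℂ a b = (Real.cos φ : ℂ))
    (Hop : ℝ → V →L[ℂ] V)
    (hHop : Hop = fun s => (1 - agF φ s) • (1 - (innerSL ℂ a).smulRight a) +
      agF φ s • (1 - (innerSL ℂ b).smulRight b))
    (P P' : ℝ → V →L[ℂ] V) (E : ℝ → ℝ) (U UA : ℝ → V →L[ℂ] V) (τ : ℝ) (hτ : 0 < τ)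
    (hPs : ∀ s ∈ Icc (0:ℝ) 1, IsSelfAdjoint (P s))
    (hPP : ∀ s ∈ Icc (0:ℝ) 1, P s ∘L P s = P s)
    (hP0 : ∀ s ∈ Icc (0:ℝ) 1, P s ≠ 0)
    (hPd : ∀ s ∈ Icc (0:ℝ) 1, HasDerivAt P (P' s) s)
    (hHP : ∀ s ∈ Icc (0:ℝ) 1, Hop s ∘L P s = (E s : ℂ) • P s)
    (hPfix : ∀ s ∈ Icc (0:ℝ) 1, ∀ v : V, Hop s v = (E s : ℂ) • v → P s v = v)
    (hmin : ∀ s ∈ Icc (0:ℝ) 1, ∀ μ : ℝ,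
      Module.End.HasEigenvalue ((Hop s).toLinearMap) ((μ : ℝ) : ℂ) → E s ≤ μ)
    (hU0 : U 0 = 1) (hUA0 : UA 0 = 1)
    (hUu : ∀ s ∈ Icc (0:ℝ) 1, ContinuousLinearMap.adjoint (U s) ∘L U s = 1 ∧
          U s ∘L ContinuousLinearMap.adjoint (U s) = 1)
    (hUAu : ∀ s ∈ Icc (0:ℝ) 1, ContinuousLinearMap.adjoint (UA s) ∘L UA s = 1 ∧
          UA s ∘L ContinuousLinearMap.adjoint (UA s) = 1)
    (hUd : ∀ s ∈ Icc (0:ℝ) 1, HasDerivAt U ((-(Complex.I * (τ : ℂ))) • (Hop s ∘L U s)) s)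
    (hUAd : ∀ s ∈ Icc (0:ℝ) 1, HasDerivAt UA
            (((-(Complex.I * (τ : ℂ))) • Hop s + (P' s ∘L P s - P s ∘L P' s)) ∘L UA s) s) :
    ‖((1 : V →L[ℂ] V) - P 0) ∘L (ContinuousLinearMap.adjoint (UA 1) ∘L U 1) ∘L P 0‖
      ≤ 16 / (τ * Real.cos φ) := by
  have hsin : 0 < Real.sin φ := Real.sin_pos_of_pos_of_lt_pi hφ (by linarith [Real.pi_pos])
  have hcos : 0 < Real.cos φ := Real.cos_pos_of_mem_Ioo ⟨by linarith, hφ2⟩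
  have m0 : (0:ℝ) ∈ Icc (0:ℝ) 1 := by simp
  have m1 : (1:ℝ) ∈ Icc (0:ℝ) 1 := by simp
  obtain ⟨-, -, -, hmaps, -, hFd, -⟩ := agF_props φ hφ hφ2
  set v : ℝ → V := fun s => (Real.sin ((1 - s) * φ) / Real.sin φ) • a
    + (Real.sin (s * φ) / Real.sin φ) • b with hv
  set w : ℝ → V := fun s => (- Real.cos ((1 - s) * φ) / Real.sin φ) • a
    + (Real.cos (s * φ) / Real.sin φ) • b with hw
  set e0 : ℝ → ℝ := fun s => 1 - ((1 - agF φ s) * Real.cos (s * φ) ^ 2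
    + agF φ s * Real.cos ((1 - s) * φ) ^ 2) with he0
  set e1 : ℝ → ℝ := fun s => 1 - ((1 - agF φ s) * Real.sin (s * φ) ^ 2
    + agF φ s * Real.sin ((1 - s) * φ) ^ 2) with he1
  have hfr := fun s => ag_frame a b φ ((1 - s) * φ) (s * φ) (by ring) hsin.ne' haa hbb hab
    (v s) (w s) rfl rfl
  have hHsa : ∀ s, IsSelfAdjoint (Hop s) := fun s => by rw [hHop]; exact ag_Hsa a b _
  have hbal : ∀ s ∈ Icc (0:ℝ) 1, (1 - agF φ s) * (Real.sin (s * φ) * Real.cos (s * φ))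
      = agF φ s * (Real.sin ((1 - s) * φ) * Real.cos ((1 - s) * φ)) := by
    intro s hs
    rw [(agF_eq φ s hφ hφ2 hs).2, (agF_eq φ s hφ hφ2 hs).1]; ring
  have hHe := fun s hs => ag_H a b (v s) (w s) ((1 - s) * φ) (s * φ) (agF φ s) (Hop s)
    (by rw [hHop]) (hfr s).1 (hfr s).2.1 (hfr s).2.2.1 (hfr s).2.2.2.1 (hfr s).2.2.2.2.1
    (hfr s).2.2.2.2.2 (hbal s hs)
  -- gap
  set h : ℝ → ℝ := fun s => Real.cos ((2 * s - 1) * φ) / Real.cos φ with hh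
  have hgap : ∀ s ∈ Icc (0:ℝ) 1, h s * (e1 s - e0 s) = 1 := by
    intro s hs
    have hc := (ag_trig φ s hφ hφ2 hs).1
    have e : e1 s - e0 s = Real.cos φ / Real.cos ((2 * s - 1) * φ) := by
      have e2 : Real.sin φ = Real.sin ((1 - s) * φ) * Real.cos (s * φ)
          + Real.cos ((1 - s) * φ) * Real.sin (s * φ) := by
        rw [← Real.sin_add]; ring_nf
      have e3 : Real.cos φ = Real.cos ((1 - s) * φ) * Real.cos (s * φ)
          - Real.sin ((1 - s) * φ) * Real.sin (s * φ) := by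
        rw [← Real.cos_add]; ring_nf
      have hx := Real.sin_sq_add_cos_sq ((1 - s) * φ)
      have hy := Real.sin_sq_add_cos_sq (s * φ)
      simp only [he1, he0]
      rw [(agF_eq φ s hφ hφ2 hs).2, (agF_eq φ s hφ hφ2 hs).1]
      generalize Real.sin (s * φ) = S at *
      generalize Real.cos (s * φ) = T at *
      generalize Real.cos ((2 * s - 1) * φ) = p at *
      generalize Real.sin ((1 - s) * φ) = S' at *
      generalize Real.cos ((1 - s) * φ) = T' at *
      field_simp
      rw [e2, e3]
      grind
    rw [e]
    simp only [hh]
    field_simp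
  have hhpos : ∀ s ∈ Icc (0:ℝ) 1, 0 < h s := fun s hs =>
    div_pos (ag_trig φ s hφ hφ2 hs).1 hcos
  have h01 : ∀ s ∈ Icc (0:ℝ) 1, e0 s < e1 s := by
    intro s hs
    have := hgap s hs
    have := hhpos s hs
    by_contra! hcon
    nlinarith
  have he01 : ∀ s ∈ Icc (0:ℝ) 1, e0 s < 1 := by
    intro s hs
    obtain ⟨-, hc1, hc2⟩ := ag_trig φ s hφ hφ2 hs
    have h3 := hmaps hs
    simp only [he0]
    have h4 : 0 ≤ (1 - agF φ s) * Real.cos (s * φ) ^ 2 :=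
      mul_nonneg (by linarith [h3.2]) (sq_nonneg _)
    have h5 : 0 ≤ agF φ s * Real.cos ((1 - s) * φ) ^ 2 := mul_nonneg h3.1 (sq_nonneg _)
    rcases h3.1.eq_or_lt with h6 | h6
    · rw [← h6]; have : 0 < Real.cos (s * φ) ^ 2 := by positivity
      linarith
    · have : 0 < agF φ s * Real.cos ((1 - s) * φ) ^ 2 := by positivity
      linarith
  have hproj : ∀ s ∈ Icc (0:ℝ) 1, ∀ x, P s x = inner ℂ (v s) x • v s := fun s hs =>
    ag_proj (Hop s) (P s) (E s) (v s) (w s) (e0 s) (e1 s) (hfr s).1 (hHsa s) (hHe s hs).1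
      (hHe s hs).2.1 (hHe s hs).2.2 (hfr s).2.2.2.1 (h01 s hs) (he01 s hs) (hPs s hs) (hP0 s hs)
      (hHP s hs) (hPfix s hs) (hmin s hs)
  have hint := ag_intertwine Hop P P' UA E τ hHsa hPs hPP hPd hHP hUA0 hUAd
  have hlin1 : ∀ s : ℝ, HasDerivAt (fun s : ℝ => (1 - s) * φ) (-φ) s := fun s => by
    simpa using ((hasDerivAt_id s).const_sub 1).mul_const φ
  have hlin2 : ∀ s : ℝ, HasDerivAt (fun s : ℝ => s * φ) φ s := fun s => by
    simpa using (hasDerivAt_id s).mul_const φ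
  have hlin3 : ∀ s : ℝ, HasDerivAt (fun s : ℝ => (2 * s - 1) * φ) (2 * φ) s := fun s => by
    simpa using (((hasDerivAt_id s).const_mul 2).sub_const 1).mul_const φ
  have hvd : ∀ s, HasDerivAt v (φ • w s) s := by
    intro s
    have h1 := (((hlin1 s).sin.div_const (Real.sin φ)).smul_const a).add
      (((hlin2 s).sin.div_const (Real.sin φ)).smul_const b)
    refine h1.congr_deriv ?_
    simp only [hw]
    module
  have hwd : ∀ s, HasDerivAt w (-φ • v s) s := by
    intro s
    have h1 := (((hlin1 s).cos.neg.div_const (Real.sin φ)).smul_const a).add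
      (((hlin2 s).cos.div_const (Real.sin φ)).smul_const b)
    refine h1.congr_deriv ?_
    simp only [hv]
    module
  have hsym : ∀ s x y, inner ℂ x (Hop s y) = inner ℂ (Hop s x) y := fun s x y => by
    rw [← ContinuousLinearMap.adjoint_inner_left, (hHsa s).adjoint_eq]
  set ψ : ℝ → V := fun s => U s (v 0) with hψ
  have hψd : ∀ s ∈ Icc (0:ℝ) 1, HasDerivAt ψ ((-(Complex.I * (τ : ℂ))) • Hop s (ψ s)) s := by
    intro s hs
    have h1 := ((ContinuousLinearMap.apply ℂ V (v 0)).restrictScalars ℝ).hasFDerivAt.comp_hasDerivAt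
      s (hUd s hs)
    refine h1.congr_deriv ?_
    simp [hψ]
  have hode := ag_ode (fun s => inner ℂ (v s) (ψ s)) (fun s => inner ℂ (w s) (ψ s)) e0 e1 h
    (fun s => -Real.sin ((2 * s - 1) * φ) * (2 * φ) / Real.cos φ) φ τ (Real.cos φ) hφ.le
    (by linarith [Real.pi_le_four]) hτ hcos
    (by
      intro s hs
      refine ((hvd s).inner ℂ (hψd s hs)).congr_deriv ?_
      rw [inner_smul_right, hsym, (hHe s hs).1, inner_smul_left, inner_smul_left_eq_smul,
        Complex.conj_ofReal, Complex.real_smul]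
      ring)
    (by
      intro s hs
      refine ((hwd s).inner ℂ (hψd s hs)).congr_deriv ?_
      rw [inner_smul_right, hsym, (hHe s hs).2.1, inner_smul_left, inner_smul_left_eq_smul,
        Complex.conj_ofReal, Complex.real_smul]
      rw [Complex.ofReal_neg]
      ring)
    (fun s hs => (hlin3 s).cos.div_const _)
    hgap
    (by
      intro s hs
      simp only [hh]
      rw [abs_div, abs_of_pos hcos]
      gcongr
      exact Real.abs_cos_le_one _)
    (by
      intro s hs
      rw [abs_div, abs_of_pos hcos, abs_mul, abs_neg, abs_of_pos (by linarith : 0 < 2 * φ)]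
      gcongr
      nlinarith [Real.abs_sin_le_one ((2 * s - 1) * φ), abs_nonneg (Real.sin ((2 * s - 1) * φ)),
        Real.pi_le_four])
    (by
      have hFc : ContinuousOn (agF φ) (Icc 0 1) :=
        fun s hs => (hFd s hs).continuousAt.continuousWithinAt
      simp only [he1]
      fun_prop)
    (by simp only [hψ, hU0]; exact (hfr 0).1)
    (by simp only [hψ, hU0]; exact (hfr 0).2.2.2.1)
  obtain ⟨hn1, hn2⟩ := hode
  -- norms
  have hvn : ∀ s, ‖v s‖ = 1 := fun s => by
    have h1 := (hfr s).1
    have h2 : ‖v s‖ ^ 2 = 1 := by rw [← inner_self_eq_norm_sq (𝕜 := ℂ), h1]; simp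
    nlinarith [norm_nonneg (v s)]
  have hUn : ∀ x, ‖U 1 x‖ = ‖x‖ :=
    (ContinuousLinearMap.norm_map_iff_adjoint_comp_self _).2 (hUu 1 m1).1
  have hUAn : ∀ x, ‖ContinuousLinearMap.adjoint (UA 1) x‖ = ‖x‖ :=
    (ContinuousLinearMap.norm_map_iff_adjoint_comp_self _).2
      (by rw [ContinuousLinearMap.adjoint_adjoint]; exact (hUAu 1 m1).2)
  have hψn : ‖ψ 1‖ = 1 := by simp only [hψ]; rw [hUn, hvn]
  have hQ : ‖ψ 1 - P 1 (ψ 1)‖ ≤ 16 / (τ * Real.cos φ) := by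
    have ho : inner ℂ (inner ℂ (v 1) (ψ 1) • v 1) (ψ 1 - inner ℂ (v 1) (ψ 1) • v 1) = 0 := by
      rw [inner_smul_left, inner_sub_right, inner_smul_right, (hfr 1).1]; ring
    have h1 := norm_add_sq_eq_norm_sq_add_norm_sq_of_inner_eq_zero _ _ ho
    rw [add_sub_cancel, hψn, norm_smul, hvn] at h1
    rw [hproj 1 m1]
    have h2 : ‖ψ 1 - inner ℂ (v 1) (ψ 1) • v 1‖ ^ 2 = ‖inner ℂ (w 1) (ψ 1)‖ ^ 2 := by
      linarith
    rw [(sq_eq_sq₀ (norm_nonneg _) (norm_nonneg _)).1 h2]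
    exact hn2
  have hcomm : ∀ y, (ContinuousLinearMap.adjoint (UA 1) y) - P 0 (ContinuousLinearMap.adjoint (UA 1) y)
      = ContinuousLinearMap.adjoint (UA 1) (y - P 1 y) := by
    intro y
    have h1 : UA 1 (ContinuousLinearMap.adjoint (UA 1) y) = y := by
      have := congrArg (fun T : V →L[ℂ] V => T y) (hUAu 1 m1).2
      simpa using this
    rw [← hint, map_sub]
    simp [ContinuousLinearMap.star_eq_adjoint, h1]
  refine ContinuousLinearMap.opNorm_le_bound _ (by positivity) fun x => ?_
  have h1 : (((1 : V →L[ℂ] V) - P 0) ∘L (ContinuousLinearMap.adjoint (UA 1) ∘L U 1) ∘L P 0) x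
      = inner ℂ (v 0) x • ContinuousLinearMap.adjoint (UA 1) (ψ 1 - P 1 (ψ 1)) := by
    rw [← hcomm]
    simp only [ContinuousLinearMap.comp_apply, sub_apply,
      one_apply_eq_self]
    rw [hproj 0 m0 x]
    simp only [map_smul, smul_sub, hψ]
  rw [h1, norm_smul, hUAn, mul_comm]
  have h2 : ‖inner ℂ (v 0) x‖ ≤ ‖x‖ := by
    have := norm_inner_le_norm (𝕜 := ℂ) (v 0) x
    rwa [hvn, one_mul] at this
  gcongr

end

/-- **Adiabatic Grover search with adapted schedule (Example, claim 2).**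

There is a constant `C > 0` such that for every `n ≥ 1` (and every marked item `u`)
there is a surjective, strictly increasing, continuously differentiable schedule
`f : [0,1] → [0,1]` with `f 0 = 0`, `f 1 = 1`, such that for the interpolating
Hamiltonian `H(s) = (1 − f(s))H₀ + f(s)H₁` on `ℂ^{2ⁿ}` (where `H₀ = 1 − |0̂⟩⟨0̂|`,
`H₁ = 1 − |e_u⟩⟨e_u|`), with `P s` the spectral projection onto the nondegenerate
ground state, `U τ` resp. `UA τ` the unitary Schrödinger resp. adiabatic propagators and
`Ω_τ(s) = UA_τ(s)* U_τ(s)` the wave operator, one has, with `g_min = 2^{−n/2}`: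
`‖Q(0) Ω_τ(1) P(0)‖ ≤ C / (τ g_min)` for all `τ > 0`. -/
theorem adiabatic_grover_adapted_schedule :
    ∃ C > (0:ℝ), ∀ n : ℕ, 1 ≤ n → ∀ u : Fin (2 ^ n),
    let V := EuclideanSpace ℂ (Fin (2 ^ n))
    let ψ0 : V := ((Real.sqrt (2 ^ n) : ℂ))⁻¹ • ∑ w, EuclideanSpace.single w (1:ℂ)
    let H0 : V →L[ℂ] V := 1 - (innerSL ℂ ψ0).smulRight ψ0
    let H1 : V →L[ℂ] V :=
      1 - (innerSL ℂ (EuclideanSpace.single u (1:ℂ))).smulRight (EuclideanSpace.single u (1:ℂ))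
    ∃ f f' : ℝ → ℝ,
      StrictMonoOn f (Set.Icc (0:ℝ) 1) ∧
      f 0 = 0 ∧ f 1 = 1 ∧
      Set.MapsTo f (Set.Icc (0:ℝ) 1) (Set.Icc (0:ℝ) 1) ∧
      Set.SurjOn f (Set.Icc (0:ℝ) 1) (Set.Icc (0:ℝ) 1) ∧
      (∀ s ∈ Set.Icc (0:ℝ) 1, HasDerivAt f (f' s) s) ∧
      ContinuousOn f' (Set.Icc (0:ℝ) 1) ∧
      (let Hop : ℝ → V →L[ℂ] V := fun s => (1 - f s) • H0 + f s • H1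
      ∀ (P P' : ℝ → V →L[ℂ] V) (E : ℝ → ℝ) (U UA : ℝ → ℝ → V →L[ℂ] V),
        -- `P` is a C¹ family of orthogonal projections:
        (∀ s ∈ Set.Icc (0:ℝ) 1, IsSelfAdjoint (P s)) →
        (∀ s ∈ Set.Icc (0:ℝ) 1, P s ∘L P s = P s) →
        (∀ s ∈ Set.Icc (0:ℝ) 1, P s ≠ 0) →
        (∀ s ∈ Set.Icc (0:ℝ) 1, HasDerivAt P (P' s) s) →
        ContinuousOn P' (Set.Icc (0:ℝ) 1) →
        -- `P s` is the spectral projection onto the lowest eigenvalue `E s` of `H s`: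
        (∀ s ∈ Set.Icc (0:ℝ) 1, Hop s ∘L P s = (E s : ℂ) • P s) →
        (∀ s ∈ Set.Icc (0:ℝ) 1, ∀ v : V, Hop s v = (E s : ℂ) • v → P s v = v) →
        (∀ s ∈ Set.Icc (0:ℝ) 1, ∀ μ : ℝ,
          Module.End.HasEigenvalue ((Hop s).toLinearMap) ((μ : ℝ) : ℂ) → E s ≤ μ) →
        -- Schrödinger and adiabatic propagators:
        (∀ τ > (0:ℝ), U τ 0 = 1) → (∀ τ > (0:ℝ), UA τ 0 = 1) →
        (∀ τ > (0:ℝ), ∀ s ∈ Set.Icc (0:ℝ) 1,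
          ContinuousLinearMap.adjoint (U τ s) ∘L U τ s = 1 ∧
          U τ s ∘L ContinuousLinearMap.adjoint (U τ s) = 1) →
        (∀ τ > (0:ℝ), ∀ s ∈ Set.Icc (0:ℝ) 1,
          ContinuousLinearMap.adjoint (UA τ s) ∘L UA τ s = 1 ∧
          UA τ s ∘L ContinuousLinearMap.adjoint (UA τ s) = 1) →
        (∀ τ > (0:ℝ), ∀ s ∈ Set.Icc (0:ℝ) 1,
          HasDerivAt (U τ) ((-(Complex.I * (τ : ℂ))) • (Hop s ∘L U τ s)) s) →
        (∀ τ > (0:ℝ), ∀ s ∈ Set.Icc (0:ℝ) 1,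
          HasDerivAt (UA τ)
            (((-(Complex.I * (τ : ℂ))) • Hop s + (P' s ∘L P s - P s ∘L P' s)) ∘L UA τ s) s) →
        ∀ τ > (0:ℝ),
          ‖((1 : V →L[ℂ] V) - P 0) ∘L
              (ContinuousLinearMap.adjoint (UA τ 1) ∘L U τ 1) ∘L P 0‖
            ≤ C / (τ * (2:ℝ) ^ (-(n:ℝ) / 2))) := by
  refine ⟨16, by norm_num, ?_⟩
  intro n hn u V ψ0 H0 H1
  have hN : (0:ℝ) < 2 ^ n := by positivity
  set g : ℝ := (Real.sqrt (2 ^ n))⁻¹ with hg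
  have hgpos : 0 < g := by positivity
  have hg1 : g < 1 := by
    apply inv_lt_one_of_one_lt₀
    rw [Real.lt_sqrt (by norm_num)]
    have : (1:ℝ) < 2 ^ n := one_lt_pow₀ (by norm_num) (by omega)
    linarith
  have hcosφ : Real.cos (Real.arccos g) = g := Real.cos_arccos (by linarith) hg1.le
  have hφ : 0 < Real.arccos g := Real.arccos_pos.2 hg1
  have hφ2 : Real.arccos g < Real.pi / 2 := Real.arccos_lt_pi_div_two.2 hgpos
  have hgpow : (2:ℝ) ^ (-(n:ℝ) / 2) = g := by
    rw [hg, Real.sqrt_eq_rpow, ← Real.rpow_natCast, ← Real.rpow_mul (by norm_num),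
      ← Real.rpow_neg (by norm_num)]
    congr 1; ring
  have hψ0 : ∀ w, ψ0 w = (g : ℂ) := by
    intro w
    simp [ψ0, hg, Finset.sum_apply, Pi.single_apply]
  have hgg : g * g * 2 ^ n = 1 := by
    rw [hg, ← mul_inv, Real.mul_self_sqrt hN.le]; field_simp
  have haa : inner ℂ ψ0 ψ0 = (1:ℂ) := by
    rw [PiLp.inner_apply]
    simp only [hψ0]
    simp [abs_of_pos hgpos]
    have : ((g:ℂ)) * g * 2 ^ n = 1 := by exact_mod_cast hgg
    linear_combination this
  have hbb : inner ℂ (EuclideanSpace.single u (1:ℂ) : V) (EuclideanSpace.single u (1:ℂ)) = (1:ℂ) := by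
    simp
  have hab : inner ℂ ψ0 (EuclideanSpace.single u (1:ℂ) : V) = (Real.cos (Real.arccos g) : ℂ) := by
    rw [hcosφ, EuclideanSpace.inner_single_right, hψ0]
    simp
  obtain ⟨p1, p2, p3, p4, p5, p6, p7⟩ := agF_props _ hφ hφ2
  refine ⟨agF (Real.arccos g), agF' (Real.arccos g), p1, p2, p3, p4, p5, p6, p7, ?_⟩
  intro Hop P P' E U UA q1 q2 q3 q4 _ q6 q7 q8 q9 q10 q11 q12 q13 q14 τ hτ
  have := ag_core ψ0 (EuclideanSpace.single u (1:ℂ) : V) _ hφ hφ2 haa hbb hab Hop rfl P P' E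
    (U τ) (UA τ) τ hτ q1 q2 q3 q4 q6 q7 q8 (q9 τ hτ) (q10 τ hτ) (q11 τ hτ) (q12 τ hτ) (q13 τ hτ)
    (q14 τ hτ)
  rw [hcosφ] at this
  rw [hgpow]
  exact this
end
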